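/- arXiv:1304.7385 — 4 statements merged into one kernel-verified Lean document; each statement's English description precedes it below -/
import Mathlib

section
/- Define f : ℝ → ℝ ∪ {+∞} by f(x) = (1/2)x − x²·sin(1/x) for x > 0, f(0) = 0, and f(x) = +∞ for x < 0. Then f is proper and lower semicontinuous, 0 ∈ ∂f(0), and there exist α, η > 0 (for instance α = 1) such that f(x) ≥ f(0) + (α/2)·x² for all x ∈ B_η(0); nevertheless, 0 is not an isolated point of (∂f)⁻¹(0), so the limiting subdifferential ∂f is not strongly metrically subregular at (0, 0). -/
open Filter Metric Topology RealInnerProductSpace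

noncomputable section

/-- The regular/Fréchet subdifferential of `f : ℝ → EReal` at `x`. -/
def FrechetSubdiffR (f : ℝ → EReal) (x : ℝ) : Set ℝ :=
  {p | f x ≠ ⊤ ∧ ∀ ε : ℝ, 0 < ε → ∃ δ : ℝ, 0 < δ ∧
    ∀ y : ℝ, |y - x| < δ → f x + ((p * (y - x) - ε * |y - x| : ℝ) : EReal) ≤ f y}

/-- The limiting subdifferential of `f : ℝ → EReal` at `x`. -/
def LimitingSubdiffR (f : ℝ → EReal) (x : ℝ) : Set ℝ :=
  {p | ∃ (xs ps : ℕ → ℝ),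
    (∀ k, ps k ∈ FrechetSubdiffR f (xs k)) ∧
    Tendsto xs atTop (𝓝 x) ∧
    Tendsto (fun k => f (xs k)) atTop (𝓝 (f x)) ∧
    Tendsto ps atTop (𝓝 p)}

def MetricallySubregularAt {A B : Type*} [PseudoMetricSpace A] [PseudoMetricSpace B]
    (F : A → Set B) (xb : A) (yb : B) (κ : ℝ) : Prop :=
  ∃ U ∈ 𝓝 xb, ∀ x ∈ U,
    EMetric.infEdist x {z | yb ∈ F z} ≤ ENNReal.ofReal κ * EMetric.infEdist yb (F x)

def StronglyMetricallySubregularAt {A B : Type*} [PseudoMetricSpace A] [PseudoMetricSpace B]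
    (F : A → Set B) (xb : A) (yb : B) (κ : ℝ) : Prop :=
  ∃ U ∈ 𝓝 xb, (∀ x ∈ U,
    EMetric.infEdist x {z | yb ∈ F z} ≤ ENNReal.ofReal κ * EMetric.infEdist yb (F x)) ∧
    {z | yb ∈ F z} ∩ U = {xb}

def MetricallyRegularAround {A B : Type*} [PseudoMetricSpace A] [PseudoMetricSpace B]
    (F : A → Set B) (xb : A) (yb : B) (κ : ℝ) : Prop :=
  ∃ U ∈ 𝓝 xb, ∃ V ∈ 𝓝 yb, ∀ x ∈ U, ∀ y ∈ V,
    EMetric.infEdist x {z | y ∈ F z} ≤ ENNReal.ofReal κ * EMetric.infEdist y (F x)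

def StronglyMetricallyRegularAround {A B : Type*} [PseudoMetricSpace A] [PseudoMetricSpace B]
    (F : A → Set B) (xb : A) (yb : B) (κ : ℝ) : Prop :=
  MetricallyRegularAround F xb yb κ ∧
  ∃ V ∈ 𝓝 yb, ∃ U ∈ 𝓝 xb, ∀ y ∈ V, ∃! x, x ∈ U ∧ y ∈ F x

/-- The function of Example 3.4. -/
def exampleFun : ℝ → EReal := fun x =>
  if 0 < x then ((x / 2 - x ^ 2 * Real.sin x⁻¹ : ℝ) : EReal)
  else if x = 0 then (0 : EReal) else ⊤


theorem exf_pos {x : ℝ} (hx : 0 < x) :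
    exampleFun x = ((x / 2 - x ^ 2 * Real.sin x⁻¹ : ℝ) : EReal) := by
  simp [exampleFun, hx]

theorem exf_zero : exampleFun 0 = 0 := by simp [exampleFun]

theorem exf_neg {x : ℝ} (hx : x < 0) : exampleFun x = ⊤ := by
  simp [exampleFun, hx.ne, hx.le]

theorem exf_growth {x : ℝ} (hx : x ≤ 1 / 3) :
    ((1 / 2 * x ^ 2 : ℝ) : EReal) ≤ exampleFun x := by
  rcases lt_trichotomy x 0 with h | h | h
  · rw [exf_neg h]; exact le_top
  · subst h; rw [exf_zero]; simp
  · rw [exf_pos h, EReal.coe_le_coe_iff]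
    nlinarith [Real.sin_le_one x⁻¹, sq_nonneg x,
      mul_nonneg (sq_nonneg x) (sub_nonneg.2 (Real.sin_le_one x⁻¹))]

theorem frechet_sub_limiting {f : ℝ → EReal} {x p : ℝ} (h : p ∈ FrechetSubdiffR f x) :
    p ∈ LimitingSubdiffR f x :=
  ⟨fun _ => x, fun _ => p, fun _ => h, tendsto_const_nhds, tendsto_const_nhds,
    tendsto_const_nhds⟩

theorem exf_lsc : LowerSemicontinuous exampleFun := by
  intro x y hy
  rcases lt_trichotomy x 0 with h | h | h
  · filter_upwards [Iio_mem_nhds h] with z hz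
    rw [exf_neg hz]; rwa [exf_neg h] at hy
  · subst h
    rw [exf_zero] at hy
    filter_upwards [Iio_mem_nhds (show (0 : ℝ) < 1 / 3 by norm_num)] with z hz
    refine lt_of_lt_of_le hy (le_trans ?_ (exf_growth (le_of_lt hz)))
    exact_mod_cast (by positivity : (0 : ℝ) ≤ 1 / 2 * z ^ 2)
  · have hc : ContinuousAt (fun x : ℝ => ((x / 2 - x ^ 2 * Real.sin x⁻¹ : ℝ) : EReal)) x := by
      refine continuous_coe_real_ereal.continuousAt.comp ?_
      have h1 : ContinuousAt (fun x : ℝ => x⁻¹) x := continuousAt_inv₀ h.ne'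
      have h2 : ContinuousAt (fun x : ℝ => Real.sin x⁻¹) x :=
        Real.continuous_sin.continuousAt.comp h1
      fun_prop
    rw [exf_pos h] at hy
    filter_upwards [hc.eventually (lt_mem_nhds hy), Ioi_mem_nhds h] with z hz hz0
    rw [exf_pos hz0]; exact hz

theorem exf_hasDeriv {x : ℝ} (hx : 0 < x) :
    HasDerivAt (fun x : ℝ => x / 2 - x ^ 2 * Real.sin x⁻¹)
      (1 / 2 - 2 * x * Real.sin x⁻¹ + Real.cos x⁻¹) x := by
  have h1 := (hasDerivAt_inv hx.ne').sin
  have h2 := ((hasDerivAt_id x).div_const 2).sub ((hasDerivAt_pow 2 x).mul h1)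
  refine h2.congr_deriv ?_
  have hx' := hx.ne'
  simp
  field_simp
  ring

theorem exf_frechet {x : ℝ} (hx : 0 < x)
    (h0 : 1 / 2 - 2 * x * Real.sin x⁻¹ + Real.cos x⁻¹ = 0) :
    (0 : ℝ) ∈ FrechetSubdiffR exampleFun x := by
  refine ⟨by rw [exf_pos hx]; exact EReal.coe_ne_top _, fun ε hε => ?_⟩
  have hd := exf_hasDeriv hx
  rw [h0, hasDerivAt_iff_isLittleO] at hd
  have he := hd.def hε
  obtain ⟨δ, hδ, H⟩ := Metric.eventually_nhds_iff.1 (he.and (Ioi_mem_nhds hx))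
  refine ⟨δ, hδ, fun y hy => ?_⟩
  obtain ⟨h1, h2⟩ := H (show dist y x < δ by rwa [Real.dist_eq])
  rw [exf_pos hx, exf_pos h2, ← EReal.coe_add, EReal.coe_le_coe_iff]
  simp only [smul_zero, sub_zero, Real.norm_eq_abs] at h1
  have := neg_abs_le (y / 2 - y ^ 2 * Real.sin y⁻¹ - (x / 2 - x ^ 2 * Real.sin x⁻¹))
  linarith

theorem exf_crit (δ : ℝ) (hδ : 0 < δ) :
    ∃ z : ℝ, 0 < z ∧ z < δ ∧ 1 / 2 - 2 * z * Real.sin z⁻¹ + Real.cos z⁻¹ = 0 := by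
  obtain ⟨n, hn⟩ := exists_nat_gt δ⁻¹
  have hn0 : (0 : ℝ) < n := lt_trans (inv_pos.2 hδ) hn
  have hpi := Real.pi_gt_three
  set a : ℝ := n * (2 * Real.pi) with ha
  have hna : (n : ℝ) < a := by nlinarith
  have ha0 : 0 < a := hn0.trans hna
  have hcont : ContinuousOn (fun t : ℝ => 1 / 2 - 2 * t⁻¹ * Real.sin t + Real.cos t)
      (Set.Icc a (a + Real.pi)) := by
    have : ContinuousOn (fun t : ℝ => t⁻¹) (Set.Icc a (a + Real.pi)) :=
      continuousOn_id.inv₀ (fun t ht => (ha0.trans_le ht.1).ne')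
    have h2 := Real.continuous_sin.continuousOn (s := Set.Icc a (a + Real.pi))
    have h3 := Real.continuous_cos.continuousOn (s := Set.Icc a (a + Real.pi))
    fun_prop
  have hs : Real.sin a = 0 := by
    have := Real.sin_nat_mul_pi (2 * n)
    rw [← this, ha]; push_cast; ring_nf
  have hc : Real.cos a = 1 := Real.cos_nat_mul_two_pi n
  have hz : (0 : ℝ) ∈ Set.Icc
      ((fun t : ℝ => 1 / 2 - 2 * t⁻¹ * Real.sin t + Real.cos t) (a + Real.pi))
      ((fun t : ℝ => 1 / 2 - 2 * t⁻¹ * Real.sin t + Real.cos t) a) := by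
    constructor
    · simp only [Real.sin_add_pi, Real.cos_add_pi, hs, hc]; norm_num
    · simp only [hs, hc]; norm_num
  obtain ⟨t, ht, h⟩ := intermediate_value_Icc' (by linarith) hcont hz
  have hta : δ⁻¹ < t := hn.trans (hna.trans_le ht.1)
  refine ⟨t⁻¹, inv_pos.2 (ha0.trans_le ht.1), inv_lt_of_inv_lt₀ hδ hta, ?_⟩
  rw [inv_inv]; exact h

theorem exf_near (δ : ℝ) (hδ : 0 < δ) :
    ∃ z : ℝ, z ≠ 0 ∧ |z| < δ ∧ (0 : ℝ) ∈ LimitingSubdiffR exampleFun z := by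
  obtain ⟨z, h0, h1, h2⟩ := exf_crit δ hδ
  exact ⟨z, h0.ne', by rwa [abs_of_pos h0], frechet_sub_limiting (exf_frechet h0 h2)⟩

/-- Example 3.4: second-order growth does not imply strong metric subregularity
of the limiting subdifferential. -/
theorem second_order_growth_without_strong_subregularity :
    (∃ x, exampleFun x ≠ ⊤) ∧ (∀ x, exampleFun x ≠ ⊥) ∧
    LowerSemicontinuous exampleFun ∧
    (0 : ℝ) ∈ LimitingSubdiffR exampleFun 0 ∧
    (∃ η : ℝ, 0 < η ∧ ∀ x ∈ Metric.closedBall (0 : ℝ) η,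
      exampleFun 0 + ((1 / 2 * x ^ 2 : ℝ) : EReal) ≤ exampleFun x) ∧
    (∀ δ : ℝ, 0 < δ → ∃ z : ℝ, z ≠ 0 ∧ |z| < δ ∧ (0 : ℝ) ∈ LimitingSubdiffR exampleFun z) ∧
    (∀ κ : ℝ, 0 < κ →
      ¬ StronglyMetricallySubregularAt (LimitingSubdiffR exampleFun) 0 0 κ) := by
  refine ⟨⟨0, by simp [exf_zero]⟩, ?_, exf_lsc, ?_, ⟨1 / 3, by norm_num, ?_⟩, exf_near, ?_⟩
  · intro x
    rcases lt_trichotomy x 0 with h | h | h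
    · rw [exf_neg h]; simp
    · subst h; rw [exf_zero]; simp
    · rw [exf_pos h]; exact EReal.coe_ne_bot _
  · refine frechet_sub_limiting ⟨by simp [exf_zero], fun ε hε => ⟨1 / 3, by norm_num, ?_⟩⟩
    intro y hy
    rw [sub_zero] at hy ⊢
    rw [exf_zero, zero_add]
    refine le_trans ?_ (exf_growth ((le_abs_self y).trans hy.le))
    rw [EReal.coe_le_coe_iff]
    nlinarith [mul_nonneg hε.le (abs_nonneg y), sq_nonneg y]
  · intro x hx
    rw [exf_zero, zero_add]
    rw [Metric.mem_closedBall, Real.dist_eq, sub_zero] at hx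
    exact exf_growth ((le_abs_self x).trans hx)
  · rintro κ - ⟨U, hU, -, h⟩
    obtain ⟨δ, hδ, hb⟩ := Metric.mem_nhds_iff.1 hU
    obtain ⟨z, hz0, hz, hm⟩ := exf_near δ hδ
    have : z ∈ ({0} : Set ℝ) := by
      rw [← h]
      exact ⟨hm, hb (by rwa [Metric.mem_ball, Real.dist_eq, sub_zero])⟩
    exact hz0 this
end
end

section
/- Let X be a Hilbert space, f : X → ℝ ∪ {+∞} a proper lower semicontinuous function, and (x̄, x̄*) ∈ gph ∂f. Then the following are equivalent: (v) ∂f is metrically regular around (x̄, x̄*) with modulus κ > 0 and there exist r ∈ [0, κ⁻¹) and neighborhoods U of x̄ and U* of x̄* such that f(x) ≥ f(u) + ⟨u*, x − u⟩ − (r/2)·‖x − u‖² for all x ∈ U and all (u, u*) ∈ gph ∂f ∩ (U × U*); (iv) the point x̄ is a local minimizer of the function x ↦ f(x) − ⟨x̄*, x⟩ and ∂f is strongly metrically regular around (x̄, x̄*) with modulus κ. -/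
open Filter Metric Topology RealInnerProductSpace

noncomputable section

variable {X : Type*} [NormedAddCommGroup X] [InnerProductSpace ℝ X]

/-- The regular/Fréchet subdifferential of `f` at `x` (Hilbert-space setting). -/
def FrechetSubdiff (f : X → EReal) (x : X) : Set X :=
  {p | f x ≠ ⊤ ∧ ∀ ε : ℝ, 0 < ε → ∃ δ : ℝ, 0 < δ ∧
    ∀ y : X, ‖y - x‖ < δ → f x + ((⟪p, y - x⟫ - ε * ‖y - x‖ : ℝ) : EReal) ≤ f y}

/-- The limiting subdifferential of `f` at `x`: sequential weak outer limit of
Fréchet subdifferentials. -/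
def LimitingSubdiff (f : X → EReal) (x : X) : Set X :=
  {p | ∃ (xs ps : ℕ → X),
    (∀ k, ps k ∈ FrechetSubdiff f (xs k)) ∧
    Tendsto xs atTop (𝓝 x) ∧
    Tendsto (fun k => f (xs k)) atTop (𝓝 (f x)) ∧
    (∀ v : X, Tendsto (fun k => ⟪ps k, v⟫) atTop (𝓝 ⟪p, v⟫))}

theorem bp_step {X : Type*} [NormedAddCommGroup X] [InnerProductSpace ℝ X]
    (D : Set X) (φ : X → ℝ) (ε l a : ℝ) (hε : 0 < ε) (hl : 0 < l) (ha : 0 < a) (_ha1 : a ≤ 1)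
    (y g : X) (hy : y ∈ D)
    (h : ∀ z ∈ D, φ y + ⟪g, z - y⟫ - (9 * ε / l ^ 2 * (1 - a)) * ‖z - y‖ ^ 2 - ε * a ^ 3 ≤ φ z) :
    ∃ y' g' : X, y' ∈ D ∧
      (∀ z ∈ D, φ y' + ⟪g', z - y'⟫ - (9 * ε / l ^ 2 * (1 - a / 2)) * ‖z - y'‖ ^ 2
        - ε * (a / 2) ^ 3 ≤ φ z) ∧
      ‖y' - y‖ ≤ l / 2 * a ∧ ‖g' - g‖ ≤ 18 * ε / l ^ 2 * ‖y' - y‖ := by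
  obtain ⟨μ, hμ⟩ : ∃ μ : ℝ, μ = 9 * ε / l ^ 2 := ⟨_, rfl⟩
  have hμ0 : 0 < μ := by rw [hμ]; positivity
  have hμl : μ * l ^ 2 = 9 * ε := by rw [hμ]; field_simp
  rw [← hμ] at h ⊢
  have h18 : 18 * ε / l ^ 2 = 2 * μ := by rw [hμ]; ring
  rw [h18]
  let ψ : X → ℝ := fun z => φ z - ⟪g, z - y⟫ + μ * (1 - a / 2) * ‖z - y‖ ^ 2
  have hlow : ∀ z ∈ D, φ y - ε * a ^ 3 + μ * (a / 2) * ‖z - y‖ ^ 2 ≤ ψ z := by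
    intro z hz
    have := h z hz
    simp only [ψ]; nlinarith
  have hbdd : BddBelow (ψ '' D) := by
    refine ⟨φ y - ε * a ^ 3, ?_⟩
    rintro _ ⟨z, hz, rfl⟩
    have := hlow z hz
    have h2 : 0 ≤ μ * (a / 2) * ‖z - y‖ ^ 2 := by positivity
    linarith
  have hne : (ψ '' D).Nonempty := ⟨_, y, hy, rfl⟩
  have hε' : 0 < ε * (a / 2) ^ 3 := by positivity
  obtain ⟨_, ⟨y', hy', rfl⟩, hlt⟩ := exists_lt_of_csInf_lt hne (lt_add_of_pos_right (sInf (ψ '' D)) hε')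
  have hmin : ∀ z ∈ D, ψ y' ≤ ψ z + ε * (a / 2) ^ 3 := by
    intro z hz
    have := csInf_le hbdd ⟨z, hz, rfl⟩
    linarith
  refine ⟨y', g - (2 * (μ * (1 - a / 2))) • (y' - y), hy', ?_, ?_, ?_⟩
  · intro z hz
    have h1 := hmin z hz
    simp only [ψ] at h1
    have e1 : z - y = (z - y') + (y' - y) := by abel
    rw [e1, norm_add_sq_real, inner_add_right] at h1
    rw [inner_sub_left, inner_smul_left]
    simp only [conj_trivial]
    rw [real_inner_comm (z - y') (y' - y)]
    nlinarith
  · have h1 := hmin y hy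
    have h2 := hlow y' hy'
    have h3 : ψ y = φ y := by simp [ψ]
    rw [h3] at h1
    have h4 : μ * (a / 2) * ‖y' - y‖ ^ 2 ≤ ε * a ^ 3 * (9 / 8) := by nlinarith
    have h5 : μ * (a / 2) * ‖y' - y‖ ^ 2 ≤ μ * (a / 2) * (l / 2 * a) ^ 2 := by
      have : μ * (a / 2) * (l / 2 * a) ^ 2 = (μ * l ^ 2) * a ^ 3 / 8 := by ring
      rw [this, hμl]; linarith
    have h6 := le_of_mul_le_mul_left h5 (by positivity)
    exact le_of_sq_le_sq h6 (by positivity)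
  · have : g - (2 * (μ * (1 - a / 2))) • (y' - y) - g = -((2 * (μ * (1 - a / 2))) • (y' - y)) := by abel
    rw [this, norm_neg, norm_smul, Real.norm_of_nonneg (by have : 0 ≤ 1 - a/2 := by linarith
                                                           positivity)]
    have : 2 * (μ * (1 - a / 2)) ≤ 2 * μ := by nlinarith
    gcongr

theorem bp {X : Type*} [NormedAddCommGroup X] [InnerProductSpace ℝ X] [CompleteSpace X]
    (D : Set X) (φ : X → ℝ) (hepi : IsClosed {p : X × ℝ | p.1 ∈ D ∧ φ p.1 ≤ p.2})
    (x : X) (hx : x ∈ D) (ε l : ℝ) (hε : 0 < ε) (hl : 0 < l)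
    (hmin : ∀ z ∈ D, φ x ≤ φ z + ε) :
    ∃ y ∈ D, ∃ G : X, ∃ μ : ℝ, 0 ≤ μ ∧ ‖y - x‖ ≤ l ∧ ‖G‖ * l ≤ 18 * ε ∧ φ y ≤ φ x + 27 * ε ∧
      ∀ z ∈ D, φ y + ⟪G, z - y⟫ - μ * ‖z - y‖ ^ 2 ≤ φ z := by
  let P : ℕ → X × X → Prop := fun n s => s.1 ∈ D ∧
    ∀ z ∈ D, φ s.1 + ⟪s.2, z - s.1⟫ - (9 * ε / l ^ 2 * (1 - (1/2)^n)) * ‖z - s.1‖ ^ 2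
      - ε * ((1/2)^n) ^ 3 ≤ φ z
  have step : ∀ n : ℕ, ∀ s : X × X, ∃ s' : X × X, P n s → (P (n+1) s' ∧
      ‖s'.1 - s.1‖ ≤ l / 2 * (1/2)^n ∧ ‖s'.2 - s.2‖ ≤ 18 * ε / l ^ 2 * ‖s'.1 - s.1‖) := by
    intro n s
    by_cases hs : P n s
    · obtain ⟨y', g', h1, h2, h3, h4⟩ := bp_step D φ ε l ((1/2)^n) hε hl (by positivity)
        (pow_le_one₀ (by norm_num) (by norm_num)) s.1 s.2 hs.1 hs.2
      refine ⟨(y', g'), fun _ => ⟨⟨h1, ?_⟩, h3, h4⟩⟩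
      have : ((1:ℝ)/2)^(n+1) = (1/2)^n / 2 := by ring
      rw [this]; exact h2
    · exact ⟨s, fun h => absurd h hs⟩
  choose nx hnx using step
  let S : ℕ → X × X := fun n => Nat.rec (x, 0) (fun n s => nx n s) n
  have hS : ∀ n, S (n+1) = nx n (S n) := fun n => rfl
  have hP : ∀ n, P n (S n) := by
    intro n
    induction n with
    | zero =>
      refine ⟨hx, fun z hz => ?_⟩
      have := hmin z hz
      simp [S]; linarith
    | succ n ih => rw [hS]; exact (hnx n _ ih).1
  have hd1 : ∀ n, dist ((S n).1) ((S (n+1)).1) ≤ l / 2 / 2^n := by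
    intro n
    have := (hnx n _ (hP n)).2.1
    rw [dist_comm, dist_eq_norm, hS]
    convert this using 1
    rw [one_div, inv_pow]; rfl
  have hd2 : ∀ n, dist ((S n).2) ((S (n+1)).2) ≤ (18 * ε / l) / 2 / 2^n := by
    intro n
    have h1 := (hnx n _ (hP n)).2.2
    have h2 := hd1 n
    rw [dist_comm, dist_eq_norm, hS] at h2 ⊢
    refine h1.trans ?_
    calc _ ≤ 18 * ε / l ^ 2 * (l / 2 / 2^n) := by gcongr
      _ = _ := by field_simp
  obtain ⟨y, hy⟩ := cauchySeq_tendsto_of_complete (cauchySeq_of_le_geometric_two hd1)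
  obtain ⟨G, hG⟩ := cauchySeq_tendsto_of_complete (cauchySeq_of_le_geometric_two hd2)
  have hyx : ‖y - x‖ ≤ l := by
    have := dist_le_of_le_geometric_two_of_tendsto₀ hd1 hy
    rw [dist_comm, dist_eq_norm] at this; exact this
  have hGn : ‖G‖ * l ≤ 18 * ε := by
    have := dist_le_of_le_geometric_two_of_tendsto₀ hd2 hG
    rw [dist_comm, dist_eq_norm] at this
    have e : (S 0).2 = 0 := rfl
    rw [e, sub_zero] at this
    rwa [le_div_iff₀ hl] at this
  have hlim : ∀ z ∈ D, y ∈ D ∧ φ y ≤ φ z - ⟪G, z - y⟫ + 9 * ε / l ^ 2 * ‖z - y‖ ^ 2 := by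
    intro z hz
    have ht : Tendsto (fun n => ((S n).1, φ z - ⟪(S n).2, z - (S n).1⟫
        + (9 * ε / l ^ 2 * (1 - (1/2)^n)) * ‖z - (S n).1‖ ^ 2 + ε * (((1:ℝ)/2)^n) ^ 3)) atTop
        (𝓝 (y, φ z - ⟪G, z - y⟫ + (9 * ε / l ^ 2 * (1 - 0)) * ‖z - y‖ ^ 2 + ε * 0 ^ 3)) := by
      have hp : Tendsto (fun n : ℕ => ((1:ℝ)/2)^n) atTop (𝓝 0) :=
        tendsto_pow_atTop_nhds_zero_of_lt_one (by norm_num) (by norm_num)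
      have hzy := (tendsto_const_nhds (x := z)).sub hy
      refine hy.prodMk_nhds (((tendsto_const_nhds.sub (hG.inner hzy)).add
        ((tendsto_const_nhds.mul (tendsto_const_nhds.sub hp)).mul (hzy.norm.pow 2))).add
        (tendsto_const_nhds.mul (hp.pow 3)))
    have := hepi.mem_of_tendsto ht (Eventually.of_forall fun n => ⟨(hP n).1, by
      have := (hP n).2 z hz
      simp only; linarith⟩)
    refine ⟨this.1, this.2.trans (le_of_eq ?_)⟩
    simp
  refine ⟨y, (hlim x hx).1, G, 9 * ε / l ^ 2, by positivity, hyx, hGn, ?_, fun z hz => ?_⟩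
  · have h1 := (hlim x hx).2
    have h2 := abs_le.1 (abs_real_inner_le_norm G (x - y))
    rw [norm_sub_rev x y] at h1 h2
    have h3 : ‖G‖ * ‖y - x‖ ≤ ‖G‖ * l := by gcongr
    have h4 : 9 * ε / l ^ 2 * ‖y - x‖ ^ 2 ≤ 9 * ε / l ^ 2 * l ^ 2 := by gcongr
    have h5 : 9 * ε / l ^ 2 * l ^ 2 = 9 * ε := by field_simp
    linarith [h2.1]
  · have := (hlim z hz).2
    linarith

/-- Perturbed variational principle producing a subgradient. -/
theorem bp_sub {X : Type*} [NormedAddCommGroup X] [InnerProductSpace ℝ X] [CompleteSpace X]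
    (D : Set X) (φ : X → ℝ) (F : X → Set X)
    (hepi : IsClosed {p : X × ℝ | p.1 ∈ D ∧ φ p.1 ≤ p.2})
    (hsub : ∀ y ∈ D, ∀ G : X, ∀ μ δ : ℝ, 0 ≤ μ → 0 < δ →
      (∀ z ∈ D, ‖z - y‖ < δ → φ y + ⟪G, z - y⟫ - μ * ‖z - y‖ ^ 2 ≤ φ z) → G ∈ F y)
    (c u q x : X) (α R ε l : ℝ) (hx : x ∈ D) (hε : 0 < ε) (hl : 0 < l) (hR : ‖x - c‖ + l < R)
    (hmin : ∀ z ∈ D, ‖z - c‖ ≤ R →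
      φ x - ⟪q, x - u⟫ - α / 2 * ‖x - u‖ ^ 2 ≤ φ z - ⟪q, z - u⟫ - α / 2 * ‖z - u‖ ^ 2 + ε) :
    ∃ y ∈ D, ∃ G : X, ‖y - x‖ ≤ l ∧ ‖G‖ * l ≤ 18 * ε ∧
      φ y - ⟪q, y - u⟫ - α / 2 * ‖y - u‖ ^ 2
        ≤ φ x - ⟪q, x - u⟫ - α / 2 * ‖x - u‖ ^ 2 + 27 * ε ∧
      q + α • (y - u) + G ∈ F y := by
  let D' : Set X := {z | z ∈ D ∧ ‖z - c‖ ≤ R}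
  let h : X → ℝ := fun z => φ z - ⟪q, z - u⟫ - α / 2 * ‖z - u‖ ^ 2
  have hepi' : IsClosed {p : X × ℝ | p.1 ∈ D' ∧ h p.1 ≤ p.2} := by
    have hc : Continuous (fun p : X × ℝ => (p.1, p.2 + ⟪q, p.1 - u⟫ + α / 2 * ‖p.1 - u‖ ^ 2)) := by
      fun_prop
    have h1 := hepi.preimage hc
    have h2 : IsClosed {p : X × ℝ | ‖p.1 - c‖ ≤ R} :=
      isClosed_le (by fun_prop) continuous_const
    convert h1.inter h2 using 1
    ext p
    simp only [D', h, Set.mem_ofPred_eq, Set.mem_inter_iff, Set.mem_preimage]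
    constructor
    · rintro ⟨⟨a, b⟩, e⟩; exact ⟨⟨a, by linarith⟩, b⟩
    · rintro ⟨⟨a, b⟩, e⟩; exact ⟨⟨a, e⟩, by linarith⟩
  obtain ⟨y, hy, G, μ, hμ, hyx, hG, hval, hineq⟩ := bp D' h hepi' x ⟨hx, by linarith⟩ ε l hε hl
    (fun z hz => hmin z hz.1 hz.2)
  refine ⟨y, hy.1, G, hyx, hG, hval, ?_⟩
  have hyc : ‖y - c‖ ≤ ‖x - c‖ + l := by
    have : y - c = (y - x) + (x - c) := by abel
    rw [this]; exact (norm_add_le _ _).trans (by linarith)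
  refine hsub y hy.1 _ (μ + |α / 2|) (R - ‖y - c‖) (by positivity) (by linarith) ?_
  intro z hz hzy
  have hzc : ‖z - c‖ ≤ R := by
    have : z - c = (z - y) + (y - c) := by abel
    rw [this]; exact (norm_add_le _ _).trans (by linarith)
  have h1 := hineq z ⟨hz, hzc⟩
  simp only [h] at h1
  have e1 : z - u = (z - y) + (y - u) := by abel
  rw [e1, norm_add_sq_real, inner_add_right] at h1
  rw [inner_add_left, inner_add_left, inner_smul_left]
  simp only [conj_trivial]
  rw [real_inner_comm (z - y) (y - u)]
  have h3 := neg_abs_le (α / 2)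
  have h4 : 0 ≤ (α / 2 + |α / 2|) * ‖z - y‖ ^ 2 := mul_nonneg (by linarith) (by positivity)
  nlinarith

/-- Local uniform quadratic lower bound with constant `β`. -/
def HypLoc {X : Type*} [NormedAddCommGroup X] [InnerProductSpace ℝ X]
    (D : Set X) (φ : X → ℝ) (F : X → Set X) (xb pb : X) (β : ℝ) : Prop :=
  ∃ ρ : ℝ, 0 < ρ ∧ ∀ u q : X, ‖u - xb‖ < ρ → q ∈ F u → ‖q - pb‖ < ρ →
    u ∈ D ∧ ∀ x ∈ D, ‖x - xb‖ < ρ → φ u + ⟪q, x - u⟫ + β / 2 * ‖x - u‖ ^ 2 ≤ φ x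

theorem core1_num (t θ σ κ β d n m g a1 a2 a3 : ℝ) (ht : 0 < t) (hθ : 0 < θ) (hθ1 : θ ≤ 1)
    (hσ0 : 0 < σ) (hσ : 164 * σ ≤ θ * t) (hκt : κ * t = θ / 8) (hβ : |β| * κ ≤ 1 - θ)
    (hd : 0 < d) (hdn : d / 2 ≤ n) (hm0 : 0 ≤ m) (hm : m ≤ θ / 8 * n) (hg0 : 0 ≤ g)
    (hg : g ≤ 18 * (σ * d)) (h1 : |a1| ≤ n * m) (h2 : |a2| ≤ g * n) (h3 : |a3| ≤ g * m)
    (key : t * n ^ 2 ≤ -(t * a1) - β * a1 - β * m ^ 2 + a2 + a3) : False := by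
  have hn : 0 < n := by linarith
  have b1 : -(t * a1) ≤ t * (θ / 8) * n ^ 2 := by
    calc -(t * a1) = t * (-a1) := by ring
      _ ≤ t * (n * m) := by gcongr; linarith [neg_abs_le a1]
      _ ≤ t * (n * (θ / 8 * n)) := by gcongr
      _ = _ := by ring
  have b2 : -(β * a1) ≤ (1 - θ) * t * n ^ 2 := by
    calc -(β * a1) ≤ |β| * |a1| := by rw [← abs_mul]; exact neg_le_abs _
      _ ≤ |β| * (n * (κ * t * n)) := by rw [hκt]; gcongr; exact h1.trans (by gcongr)
      _ = (|β| * κ) * (t * n ^ 2) := by ring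
      _ ≤ (1 - θ) * (t * n ^ 2) := by gcongr
      _ = _ := by ring
  have b3 : -(β * m ^ 2) ≤ θ / 8 * t * n ^ 2 := by
    calc -(β * m ^ 2) ≤ |β| * m ^ 2 := by nlinarith [neg_abs_le β, sq_nonneg m]
      _ = |β| * (m * m) := by ring
      _ ≤ |β| * ((κ * t * n) * (θ / 8 * n)) := by rw [hκt]; gcongr
      _ = (|β| * κ) * (θ / 8 * t * n ^ 2) := by ring
      _ ≤ 1 * (θ / 8 * t * n ^ 2) := by gcongr; linarith
      _ = _ := by ring
  have b4 : a2 + a3 ≤ θ * t / 4 * n ^ 2 := by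
    have hgn : g ≤ 36 * σ * n := by nlinarith
    have hmn : m ≤ n / 8 := by nlinarith
    calc a2 + a3 ≤ g * (n + m) := by linarith [le_abs_self a2, le_abs_self a3]
      _ ≤ (36 * σ * n) * (n + n / 8) := by gcongr
      _ = (41 * σ - σ / 2) * n ^ 2 := by ring
      _ ≤ θ * t / 4 * n ^ 2 := by gcongr; linarith
  have : 0 < t * θ * n ^ 2 := by positivity
  nlinarith

set_option maxHeartbeats 1000000 in
theorem core1_step {X : Type*} [NormedAddCommGroup X] [InnerProductSpace ℝ X] [CompleteSpace X]
    (D : Set X) (φ : X → ℝ) (F : X → Set X)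
    (hepi : IsClosed {p : X × ℝ | p.1 ∈ D ∧ φ p.1 ≤ p.2})
    (hsub : ∀ y ∈ D, ∀ G : X, ∀ μ δ : ℝ, 0 ≤ μ → 0 < δ →
      (∀ z ∈ D, ‖z - y‖ < δ → φ y + ⟪G, z - y⟫ - μ * ‖z - y‖ ^ 2 ≤ φ z) → G ∈ F y)
    (xb pb : X) (κ θ ρA : ℝ) (hκ : 0 < κ) (hθ : 0 < θ) (hθ1 : θ ≤ 1) (hρA : 0 < ρA)
    (haubin : ∀ x q y : X, ‖x - xb‖ < ρA → q ∈ F x → ‖y - pb‖ < ρA →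
      ∃ z, y ∈ F z ∧ ‖z - x‖ ≤ κ * ‖y - q‖) :
    ∃ ε : ℝ, 0 < ε ∧ ∀ β : ℝ, |β| * κ ≤ 1 - θ → HypLoc D φ F xb pb β →
      HypLoc D φ F xb pb (β + ε) := by
  obtain ⟨t, ht⟩ : ∃ t : ℝ, t = θ / (8 * κ) := ⟨_, rfl⟩
  have ht0 : 0 < t := by rw [ht]; positivity
  have hκt : κ * t = θ / 8 := by rw [ht]; field_simp
  obtain ⟨σ, hσ0, hσ1, hσ2⟩ : ∃ σ : ℝ, 0 < σ ∧ σ ≤ 1 / 2 ∧ 164 * σ ≤ θ * t :=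
    ⟨min (1/2) (θ * t / 164), by positivity, min_le_left _ _, by
      have := min_le_right (1/2) (θ * t / 164); linarith⟩
  refine ⟨2 * σ ^ 2, by positivity, ?_⟩
  rintro β hβ ⟨ρ', hρ', hyp'⟩
  obtain ⟨ρ, hρ, hρle, hρle'⟩ : ∃ ρ : ℝ, 0 < ρ ∧ ρ ≤ ρ' ∧ ρ ≤ ρA :=
    ⟨min ρ' ρA, by positivity, min_le_left _ _, min_le_right _ _⟩
  have hyp : ∀ u q : X, ‖u - xb‖ < ρ → q ∈ F u → ‖q - pb‖ < ρ →
    u ∈ D ∧ ∀ x ∈ D, ‖x - xb‖ < ρ → φ u + ⟪q, x - u⟫ + β / 2 * ‖x - u‖ ^ 2 ≤ φ x := by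
    intro u q h1 h2 h3
    obtain ⟨h4, h5⟩ := hyp' u q (by linarith) h2 (by linarith)
    exact ⟨h4, fun x hx hx' => h5 x hx (by linarith)⟩
  clear hyp'
  have hβ' : |β| ≤ 1 / κ := by rw [le_div_iff₀ hκ]; linarith
  obtain ⟨k, hk⟩ : ∃ k : ℝ, k = 1 / κ := ⟨_, rfl⟩
  have hk0 : 0 < k := by rw [hk]; positivity
  have htk : t ≤ k / 8 := by
    rw [ht, hk]
    rw [div_le_iff₀ (by positivity)]
    have : 1 / κ / 8 * (8 * κ) = 1 := by field_simp
    linarith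
  rw [← hk] at hβ'
  obtain ⟨ρ1, hρ1⟩ : ∃ ρ1 : ℝ, ρ1 = ρ / (20 + 4 * k) := ⟨_, rfl⟩
  have hρ10 : 0 < ρ1 := by rw [hρ1]; positivity
  have hρ1e : 20 * ρ1 + 4 * (ρ1 * k) = ρ := by rw [hρ1]; field_simp
  have hρk : 0 < ρ1 * k := by positivity
  refine ⟨ρ1, hρ10, fun u q hu hq hqp => ?_⟩
  obtain ⟨huD, huineq⟩ := hyp u q (by linarith) hq (by linarith)
  refine ⟨huD, fun x hx hxb => ?_⟩
  by_contra hcon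
  push Not at hcon
  have hd0 : 0 < ‖x - u‖ := by
    rcases (norm_nonneg (x - u)).lt_or_eq with h | h
    · exact h
    · exfalso
      have : x = u := by rw [← sub_eq_zero, ← norm_eq_zero]; exact h.symm
      subst this; simp at hcon
  obtain ⟨d, hd⟩ : ∃ d : ℝ, d = ‖x - u‖ := ⟨_, rfl⟩
  have hd2 : d < 2 * ρ1 := by
    have e : x - u = (x - xb) - (u - xb) := by abel
    rw [hd, e]
    exact (norm_sub_le _ _).trans_lt (by linarith)
  rw [← hd] at hcon hd0
  have hσd : σ * d ≤ ρ1 := by nlinarith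
  obtain ⟨x', hx', G, hx'x, hG, -, hq'⟩ := bp_sub D φ F hepi hsub x u q x β (ρ / 2) (σ ^ 2 * d ^ 2)
    (σ * d) hx (by positivity) (by positivity) (by simp; linarith) (by
      intro z hz hzx
      have hzb : ‖z - xb‖ < ρ := by
        have e : z - xb = (z - x) + (x - xb) := by abel
        rw [e]; exact (norm_add_le _ _).trans_lt (by linarith)
      have := huineq z hz hzb
      rw [← hd]
      nlinarith)
  have hG' : ‖G‖ ≤ 18 * (σ * d) := by
    have : ‖G‖ * (σ * d) ≤ (18 * (σ * d)) * (σ * d) := by linarith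
    exact le_of_mul_le_mul_right this (by positivity)
  obtain ⟨E, hE⟩ : ∃ E : X, E = x' - u := ⟨_, rfl⟩
  rw [← hE] at hq'
  have hE1 : ‖E‖ ≤ 3 * ρ1 := by
    have e : E = (x' - x) + (x - u) := by rw [hE]; abel
    rw [e]; exact (norm_add_le _ _).trans (by linarith)
  have hE2 : d / 2 ≤ ‖E‖ := by
    have e : x - u = E - (x' - x) := by rw [hE]; abel
    have h1 := norm_sub_le E (x' - x)
    rw [← e, ← hd] at h1
    nlinarith
  have hx'b : ‖x' - xb‖ ≤ 2 * ρ1 := by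
    have e : x' - xb = (x' - x) + (x - xb) := by abel
    rw [e]; exact (norm_add_le _ _).trans (by linarith)
  have hGρ : ‖G‖ ≤ 18 * ρ1 := by linarith
  have hq''b : ‖(q + β • E + G - t • E) - pb‖ < ρ := by
    have e : (q + β • E + G - t • E) - pb = (q - pb) + β • E + G - t • E := by abel
    rw [e]
    have h1 := norm_sub_le ((q - pb) + β • E + G) (t • E)
    have h2 := norm_add_le ((q - pb) + β • E) G
    have h3 := norm_add_le (q - pb) (β • E)
    rw [norm_smul, Real.norm_eq_abs] at h1 h3
    rw [abs_of_pos ht0] at h1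
    have h4 : |β| * ‖E‖ ≤ k * (3 * ρ1) := by gcongr
    have h5 : t * ‖E‖ ≤ (k / 8) * (3 * ρ1) := by gcongr
    nlinarith
  obtain ⟨x'', hx''F, hx''⟩ := haubin x' _ _ (by linarith) hq' (hq''b.trans_le hρle')
  obtain ⟨Δ, hΔ⟩ : ∃ Δ : X, Δ = x'' - x' := ⟨_, rfl⟩
  have hΔn : ‖Δ‖ ≤ θ / 8 * ‖E‖ := by
    have e : (q + β • E + G - t • E) - (q + β • E + G) = -(t • E) := by abel
    rw [e, norm_neg, norm_smul, Real.norm_of_nonneg ht0.le, ← hΔ, ← mul_assoc, hκt] at hx''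
    exact hx''
  have hx''b : ‖x'' - xb‖ < ρ := by
    have e : x'' - xb = Δ + (x' - xb) := by rw [hΔ]; abel
    rw [e]; refine (norm_add_le _ _).trans_lt ?_
    have : θ / 8 * ‖E‖ ≤ 1 / 8 * ‖E‖ := by gcongr
    linarith
  obtain ⟨hx''D, hx''i⟩ := hyp x'' _ hx''b hx''F hq''b
  have i1 := hx''i u huD (by linarith)
  have i2 := huineq x'' hx''D hx''b
  have e1 : x'' - u = E + Δ := by rw [hΔ, hE]; abel
  have e2 : u - x'' = -(E + Δ) := by rw [hΔ, hE]; abel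
  rw [e1] at i2
  rw [e2, norm_neg] at i1
  rw [norm_add_sq_real] at i1 i2
  simp only [inner_neg_right, inner_add_left, inner_sub_left, inner_add_right, inner_smul_left,
    conj_trivial, real_inner_self_eq_norm_sq] at i1 i2
  have a1 := abs_real_inner_le_norm E Δ
  have a2 := abs_real_inner_le_norm G E
  have a3 := abs_real_inner_le_norm G Δ
  have key : t * ‖E‖ ^ 2 ≤ -(t * ⟪E, Δ⟫) - β * ⟪E, Δ⟫ - β * ‖Δ‖ ^ 2 + ⟪G, E⟫ + ⟪G, Δ⟫ := by
    linarith
  exact core1_num t θ σ κ β d ‖E‖ ‖Δ‖ ‖G‖ _ _ _ ht0 hθ hθ1 hσ0 hσ2 hκt hβ hd0 hE2 (norm_nonneg _)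
    hΔn (norm_nonneg _) hG' a1 a2 a3 key

theorem core1 {X : Type*} [NormedAddCommGroup X] [InnerProductSpace ℝ X] [CompleteSpace X]
    (D : Set X) (φ : X → ℝ) (F : X → Set X)
    (hepi : IsClosed {p : X × ℝ | p.1 ∈ D ∧ φ p.1 ≤ p.2})
    (hsub : ∀ y ∈ D, ∀ G : X, ∀ μ δ : ℝ, 0 ≤ μ → 0 < δ →
      (∀ z ∈ D, ‖z - y‖ < δ → φ y + ⟪G, z - y⟫ - μ * ‖z - y‖ ^ 2 ≤ φ z) → G ∈ F y)
    (xb pb : X) (κ r ρA : ℝ) (hκ : 0 < κ) (hr : 0 ≤ r) (hrκ : r * κ < 1) (hρA : 0 < ρA)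
    (haubin : ∀ x q y : X, ‖x - xb‖ < ρA → q ∈ F x → ‖y - pb‖ < ρA →
      ∃ z, y ∈ F z ∧ ‖z - x‖ ≤ κ * ‖y - q‖)
    (h : HypLoc D φ F xb pb (-r)) : ∃ β : ℝ, 0 < β ∧ HypLoc D φ F xb pb β := by
  obtain ⟨ε, hε, hstep⟩ := core1_step D φ F hepi hsub xb pb κ (1 - r * κ) ρA hκ (by linarith)
    (by nlinarith) hρA haubin
  have hind : ∀ n : ℕ, (∃ β : ℝ, 0 < β ∧ HypLoc D φ F xb pb β) ∨
      HypLoc D φ F xb pb (-r + n * ε) := by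
    intro n
    induction n with
    | zero => right; simpa using h
    | succ n ih =>
      rcases ih with ih | ih
      · exact Or.inl ih
      · by_cases hp : 0 < -r + n * ε
        · exact Or.inl ⟨_, hp, ih⟩
        · right
          have hn : 0 ≤ n * ε := by positivity
          have := hstep (-r + n * ε) (by
            rw [abs_of_nonpos (by linarith)]; nlinarith) ih
          convert this using 1
          push_cast; ring
  obtain ⟨n, hn⟩ := exists_nat_gt (r / ε)
  rcases hind n with h1 | h1
  · exact h1
  · refine ⟨_, ?_, h1⟩
    rw [div_lt_iff₀ hε] at hn; linarith

set_option maxHeartbeats 1000000 in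
theorem core2 {X : Type*} [NormedAddCommGroup X] [InnerProductSpace ℝ X] [CompleteSpace X]
    (D : Set X) (φ : X → ℝ) (F : X → Set X)
    (hepi : IsClosed {p : X × ℝ | p.1 ∈ D ∧ φ p.1 ≤ p.2})
    (hsub : ∀ y ∈ D, ∀ G : X, ∀ μ δ : ℝ, 0 ≤ μ → 0 < δ →
      (∀ z ∈ D, ‖z - y‖ < δ → φ y + ⟪G, z - y⟫ - μ * ‖z - y‖ ^ 2 ≤ φ z) → G ∈ F y)
    (xb pb : X) (hxbD : xb ∈ D) (hgph : pb ∈ F xb) (κ ρ : ℝ) (hκ : 0 < κ) (hρ : 0 < ρ)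
    (haubin : ∀ x q y : X, ‖x - xb‖ < ρ → q ∈ F x → ‖y - pb‖ < ρ →
      ∃ z, y ∈ F z ∧ ‖z - x‖ ≤ κ * ‖y - q‖)
    (hmin : ∀ x ∈ D, ‖x - xb‖ < ρ → φ xb + ⟪pb, x - xb⟫ ≤ φ x)
    (huniq : ∀ y x₁ x₂ : X, ‖y - pb‖ < ρ → ‖x₁ - xb‖ < ρ → ‖x₂ - xb‖ < ρ →
      y ∈ F x₁ → y ∈ F x₂ → x₁ = x₂) : HypLoc D φ F xb pb 0 := by
  obtain ⟨β, hβ⟩ : ∃ β : ℝ, β = 1 / (72 * κ) := ⟨_, rfl⟩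
  have hβ0 : 0 < β := by rw [hβ]; positivity
  have hκβ : κ * β = 1 / 72 := by rw [hβ]; field_simp
  have growth : ∀ x ∈ D, ‖x - xb‖ < ρ / 4 →
      φ xb + ⟪pb, x - xb⟫ + β / 2 * ‖x - xb‖ ^ 2 ≤ φ x := by
    intro x hx hxb
    by_contra hcon
    push Not at hcon
    have hd0 : 0 < ‖x - xb‖ := by
      rcases (norm_nonneg (x - xb)).lt_or_eq with h | h
      · exact h
      · exfalso
        have : x = xb := by rw [← sub_eq_zero, ← norm_eq_zero]; exact h.symm
        subst this; simp at hcon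
    obtain ⟨d, hd⟩ : ∃ d : ℝ, d = ‖x - xb‖ := ⟨_, rfl⟩
    rw [← hd] at hcon hd0 hxb
    obtain ⟨y, hy, G, hyx, hG, -, hq⟩ := bp_sub D φ F hepi hsub x xb pb x 0 (ρ / 2)
      (β * d ^ 2 / 2) (d / 2) hx (by positivity) (by positivity) (by simp; linarith) (by
        intro z hz hzx
        have hzb : ‖z - xb‖ < ρ := by
          have e : z - xb = (z - x) + (x - xb) := by abel
          rw [e]; exact (norm_add_le _ _).trans_lt (by linarith)
        have := hmin z hz hzb
        linarith)
    have hG' : ‖G‖ ≤ 18 * β * d := by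
      have : ‖G‖ * (d / 2) ≤ (18 * β * d) * (d / 2) := by linarith
      exact le_of_mul_le_mul_right this (by positivity)
    rw [zero_smul, add_zero] at hq
    have hyb : ‖y - xb‖ < ρ := by
      have e : y - xb = (y - x) + (x - xb) := by abel
      rw [e]; exact (norm_add_le _ _).trans_lt (by linarith)
    obtain ⟨z, hz, hzy⟩ := haubin y _ pb hyb hq (by simpa using hρ)
    have hzy' : ‖z - y‖ ≤ d / 4 := by
      have e : pb - (pb + G) = -G := by abel
      rw [e, norm_neg] at hzy
      calc ‖z - y‖ ≤ κ * ‖G‖ := hzy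
        _ ≤ κ * (18 * β * d) := by gcongr
        _ = 18 * (κ * β) * d := by ring
        _ = d / 4 := by rw [hκβ]; ring
    have hyb' : ‖y - xb‖ ≤ d / 2 + d := by
      have e : y - xb = (y - x) + (x - xb) := by abel
      rw [e]; exact (norm_add_le _ _).trans (by linarith)
    have hzb : ‖z - xb‖ < ρ := by
      have e : z - xb = (z - y) + (y - xb) := by abel
      rw [e]; exact (norm_add_le _ _).trans_lt (by linarith)
    have hzeq := huniq pb z xb (by simpa using hρ) hzb (by simpa using hρ) hz hgph
    subst hzeq
    have e : x - z = -(y - x) - (z - y) := by abel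
    have := norm_sub_le (-(y - x)) (z - y)
    rw [← e, norm_neg, ← hd] at this
    linarith
  obtain ⟨R, hR⟩ : ∃ R : ℝ, R = ρ / 8 := ⟨_, rfl⟩
  have hR0 : 0 < R := by rw [hR]; positivity
  obtain ⟨ρ2, hρ20, hρ2a, hρ2b⟩ : ∃ ρ2 : ℝ, 0 < ρ2 ∧ ρ2 ≤ β * R / 16 ∧ ρ2 ≤ R :=
    ⟨min (β * R / 16) R, by positivity, min_le_left _ _, min_le_right _ _⟩
  refine ⟨ρ2, hρ20, fun u q hu hq hqp => ?_⟩
  let h : X → ℝ := fun z => φ z - ⟪q, z - xb⟫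
  let C : Set X := {z | z ∈ D ∧ ‖z - xb‖ ≤ R}
  have hlow : ∀ z ∈ C, φ xb - ρ2 * ‖z - xb‖ + β / 2 * ‖z - xb‖ ^ 2 ≤ h z := by
    rintro z ⟨hz, hzR⟩
    have h1 := growth z hz (by linarith)
    have h2 := real_inner_le_norm (q - pb) (z - xb)
    have h3 : ‖q - pb‖ * ‖z - xb‖ ≤ ρ2 * ‖z - xb‖ := by gcongr
    rw [inner_sub_left] at h2
    simp only [h]; linarith
  have hbdd : BddBelow (h '' C) := by
    refine ⟨φ xb - ρ2 * R, ?_⟩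
    rintro _ ⟨z, hz, rfl⟩
    have h1 := hlow z hz
    have h2 : ρ2 * ‖z - xb‖ ≤ ρ2 * R := by gcongr; exact hz.2
    have h3 : 0 ≤ β / 2 * ‖z - xb‖ ^ 2 := by positivity
    linarith
  have hxbC : xb ∈ C := ⟨hxbD, by simpa using hR0.le⟩
  have hne : (h '' C).Nonempty := ⟨_, xb, hxbC, rfl⟩
  obtain ⟨m, hm⟩ : ∃ m : ℝ, m = sInf (h '' C) := ⟨_, rfl⟩
  have hm_le : ∀ z ∈ C, m ≤ h z := fun z hz => by rw [hm]; exact csInf_le hbdd ⟨z, hz, rfl⟩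
  have hm_xb : m ≤ φ xb := by have := hm_le xb hxbC; simpa [h] using this
  have approx : ∀ η : ℝ, 0 < η → ∃ y ∈ D, ‖y - u‖ ≤ η ∧ h y ≤ m + η := by
    intro η hη
    obtain ⟨s, hs0, hs1, hs2, hs3, hs4, hs5⟩ : ∃ s : ℝ, 0 < s ∧ s ≤ R / 4 ∧ s ≤ β * R / 16 ∧ s ≤ 1 ∧
        s * (28 + 18 * κ) ≤ η ∧ s * (28 + 18 * κ) ≤ ρ / 4 := by
      refine ⟨min (R / 4) (min (β * R / 16) (min 1 (min η (ρ / 4) / (28 + 18 * κ)))), by positivity,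
        min_le_left _ _, (min_le_right _ _).trans (min_le_left _ _),
        (min_le_right _ _).trans ((min_le_right _ _).trans (min_le_left _ _)), ?_, ?_⟩
      · rw [← le_div_iff₀ (by positivity)]
        refine (min_le_right _ _).trans ((min_le_right _ _).trans ((min_le_right _ _).trans ?_))
        gcongr; exact min_le_left _ _
      · rw [← le_div_iff₀ (by positivity)]
        refine (min_le_right _ _).trans ((min_le_right _ _).trans ((min_le_right _ _).trans ?_))
        gcongr; exact min_le_right _ _
    have hss : 0 < s ^ 2 := by positivity
    have hκs : 0 < κ * s := by positivity
    obtain ⟨_, ⟨x, hx, rfl⟩, hlt⟩ := exists_lt_of_csInf_lt hne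
      (lt_add_of_pos_right (sInf (h '' C)) hss)
    rw [← hm] at hlt
    have hxR : ‖x - xb‖ ≤ R / 2 := by
      by_contra hc
      push Not at hc
      have h1 := hlow x hx
      obtain ⟨w, hw⟩ : ∃ w : ℝ, w = ‖x - xb‖ := ⟨_, rfl⟩
      rw [← hw] at h1 hc
      have h2 : β / 2 * w ^ 2 < ρ2 * w + s ^ 2 := by linarith
      have h3 : s ^ 2 ≤ (β * R / 16) * (R / 4) := by rw [sq]; gcongr
      have hw0 : 0 ≤ w := by linarith
      have h4 : ρ2 * w ≤ β * R / 16 * w := by gcongr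
      have h5 : 0 < β * w * (w - R / 2) := by
        have : 0 < w - R / 2 := by linarith
        have : 0 < w := by linarith
        positivity
      have h6 : 0 < β * R * (w - R / 2) := by
        have : 0 < w - R / 2 := by linarith
        positivity
      have h7 : 0 < β * R * R := by positivity
      nlinarith
    obtain ⟨y, hy, G, hyx, hG, hval, hqF⟩ := bp_sub D φ F hepi hsub xb xb q x 0 R
      (s ^ 2) s hx.1 hss hs0 (by linarith) (by
        intro z hz hzx
        have := hm_le z ⟨hz, hzx⟩
        simp only [h] at this hlt
        linarith)
    have hG' : ‖G‖ ≤ 18 * s := by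
      have : ‖G‖ * s ≤ (18 * s) * s := by linarith
      exact le_of_mul_le_mul_right this hs0
    rw [zero_smul, add_zero] at hqF
    have hyb : ‖y - xb‖ ≤ R := by
      have e : y - xb = (y - x) + (x - xb) := by abel
      rw [e]; exact (norm_add_le _ _).trans (by linarith)
    obtain ⟨z, hz, hzy⟩ := haubin y _ q (by linarith) hqF (by linarith)
    have hzy' : ‖z - y‖ ≤ 18 * (κ * s) := by
      have e : q - (q + G) = -G := by abel
      rw [e, norm_neg] at hzy
      calc ‖z - y‖ ≤ κ * ‖G‖ := hzy
        _ ≤ κ * (18 * s) := by gcongr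
        _ = _ := by ring
    have hzb : ‖z - xb‖ < ρ := by
      have e : z - xb = (z - y) + (y - xb) := by abel
      rw [e]; exact (norm_add_le _ _).trans_lt (by linarith)
    have hzeq := huniq q z u (by linarith) hzb (by linarith) hz hq
    subst hzeq
    refine ⟨y, hy, ?_, ?_⟩
    · rw [norm_sub_rev]; linarith
    · have : s ^ 2 ≤ s := by nlinarith
      simp only [h] at hlt ⊢
      linarith
  choose! y hyD hyu hym using fun n : ℕ => approx (1 / ((n : ℝ) + 1)) (by positivity)
  have hη := tendsto_one_div_add_atTop_nhds_zero_nat (𝕜 := ℝ)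
  have hyt : Tendsto y atTop (𝓝 u) := by
    rw [tendsto_iff_norm_sub_tendsto_zero]
    exact squeeze_zero (fun _ => norm_nonneg _) hyu hη
  have ht : Tendsto (fun n : ℕ => (y n, m + 1 / ((n : ℝ) + 1) + ⟪q, y n - xb⟫)) atTop
      (𝓝 (u, m + 0 + ⟪q, u - xb⟫)) :=
    hyt.prodMk_nhds ((tendsto_const_nhds.add hη).add
      (tendsto_const_nhds.inner (hyt.sub tendsto_const_nhds)))
  have hmem := hepi.mem_of_tendsto ht (Eventually.of_forall fun n => ⟨hyD n, by
    have := hym n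
    simp only [h] at this ⊢; linarith⟩)
  refine ⟨hmem.1, fun x hx hxb => ?_⟩
  have h1 : φ u ≤ m + 0 + ⟪q, u - xb⟫ := hmem.2
  have h2 := hm_le x ⟨hx, by linarith⟩
  have e : x - u = (x - xb) - (u - xb) := by abel
  rw [e, inner_sub_right]
  simp only [h] at h2
  linarith

theorem aubin_of_regular {X : Type*} [NormedAddCommGroup X]
    (F : X → Set X) (xb pb : X) (κ κ' : ℝ) (hκ : 0 < κ) (hκ' : κ < κ')
    (h : MetricallyRegularAround F xb pb κ) :
    ∃ ρ : ℝ, 0 < ρ ∧ ∀ x q y : X, ‖x - xb‖ < ρ → q ∈ F x → ‖y - pb‖ < ρ →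
      ∃ z, y ∈ F z ∧ ‖z - x‖ ≤ κ' * ‖y - q‖ := by
  obtain ⟨U, hU, V, hV, h⟩ := h
  obtain ⟨a, ha, haU⟩ := Metric.mem_nhds_iff.1 hU
  obtain ⟨b, hb, hbV⟩ := Metric.mem_nhds_iff.1 hV
  refine ⟨min a b, by positivity, fun x q y hx hq hy => ?_⟩
  by_cases hyq : y = q
  · subst hyq
    exact ⟨x, hq, by simp⟩
  have hpos : 0 < ‖y - q‖ := norm_pos_iff.2 (sub_ne_zero.2 hyq)
  have h1 := h x (haU (by rw [mem_ball, dist_eq_norm]; exact hx.trans_le (min_le_left _ _)))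
    y (hbV (by rw [mem_ball, dist_eq_norm]; exact hy.trans_le (min_le_right _ _)))
  have h2 : EMetric.infEdist x {z | y ∈ F z} < ENNReal.ofReal (κ' * ‖y - q‖) := by
    refine h1.trans_lt ?_
    calc ENNReal.ofReal κ * EMetric.infEdist y (F x) ≤ ENNReal.ofReal κ * edist y q := by
          gcongr; exact Metric.infEDist_le_edist_of_mem hq
      _ = ENNReal.ofReal (κ * ‖y - q‖) := by
          rw [edist_dist, dist_eq_norm, ENNReal.ofReal_mul hκ.le]
      _ < _ := by
          rw [ENNReal.ofReal_lt_ofReal_iff (by have := hκ.trans hκ'; positivity)]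
          gcongr
  obtain ⟨z, hz, hzx⟩ := Metric.infEDist_lt_iff.1 h2
  refine ⟨z, hz, ?_⟩
  rw [edist_dist, ENNReal.ofReal_lt_ofReal_iff (by have := hκ.trans hκ'; positivity), dist_comm,
    dist_eq_norm] at hzx
  exact hzx.le

theorem frechet_subset_limiting {X : Type*} [NormedAddCommGroup X] [InnerProductSpace ℝ X]
    (f : X → EReal) (x p : X) (h : p ∈ FrechetSubdiff f x) : p ∈ LimitingSubdiff f x :=
  ⟨fun _ => x, fun _ => p, fun _ => h, tendsto_const_nhds, tendsto_const_nhds,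
    fun _ => tendsto_const_nhds⟩

theorem epi_closed {X : Type*} [NormedAddCommGroup X]
    (f : X → EReal) (hbot : ∀ x, f x ≠ ⊥) (hlsc : LowerSemicontinuous f) :
    IsClosed {p : X × ℝ | p.1 ∈ {x | f x ≠ ⊤} ∧ (f p.1).toReal ≤ p.2} := by
  have hc : Continuous (fun p : X × ℝ => (p.1, (p.2 : EReal))) :=
    continuous_fst.prodMk (continuous_coe_real_ereal.comp continuous_snd)
  convert hlsc.isClosed_epigraph.preimage hc using 1
  ext p
  simp only [Set.mem_ofPred_eq, Set.mem_preimage]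
  constructor
  · rintro ⟨h1, h2⟩
    rw [← EReal.coe_toReal h1 (hbot _)]
    exact_mod_cast h2
  · intro h
    have h1 : f p.1 ≠ ⊤ := fun h' => by rw [h'] at h; exact absurd h (by simp)
    refine ⟨h1, ?_⟩
    rw [← EReal.coe_toReal h1 (hbot _)] at h
    exact_mod_cast h

theorem subgrad_mem {X : Type*} [NormedAddCommGroup X] [InnerProductSpace ℝ X]
    (f : X → EReal) (hbot : ∀ x, f x ≠ ⊥) :
    ∀ y ∈ {x | f x ≠ ⊤}, ∀ G : X, ∀ μ δ : ℝ, 0 ≤ μ → 0 < δ →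
      (∀ z ∈ {x | f x ≠ ⊤}, ‖z - y‖ < δ →
        (f y).toReal + ⟪G, z - y⟫ - μ * ‖z - y‖ ^ 2 ≤ (f z).toReal) → G ∈ LimitingSubdiff f y := by
  intro y hy G μ δ hμ hδ h
  refine frechet_subset_limiting f y G ⟨hy, fun ε hε => ?_⟩
  refine ⟨min δ (ε / (μ + 1)), by positivity, fun z hz => ?_⟩
  by_cases hzt : f z = ⊤
  · rw [hzt]; exact le_top
  have h1 := h z hzt (hz.trans_le (min_le_left _ _))
  have h2 : ‖z - y‖ * (μ + 1) ≤ ε := by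
    rw [← le_div_iff₀ (by positivity)]; exact hz.le.trans (min_le_right _ _)
  have h3 : μ * ‖z - y‖ ^ 2 ≤ ε * ‖z - y‖ := by nlinarith [norm_nonneg (z - y), sq_nonneg ‖z - y‖]
  rw [← EReal.coe_toReal hy (hbot _), ← EReal.coe_toReal hzt (hbot _)]
  norm_cast
  linarith


/-- Corollary 3.8: in Hilbert spaces, condition (v) is equivalent to condition (iv)
of Theorem 3.7. -/
theorem metric_regularity_hilbert_characterization {X : Type*} [NormedAddCommGroup X] [InnerProductSpace ℝ X] [CompleteSpace X]
    (f : X → EReal)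
    (hproper : ∃ x, f x ≠ ⊤) (hbot : ∀ x, f x ≠ ⊥) (hlsc : LowerSemicontinuous f)
    (xb pb : X) (hgph : pb ∈ LimitingSubdiff f xb) (κ : ℝ) (hκ : 0 < κ) :
    (MetricallyRegularAround (LimitingSubdiff f) xb pb κ ∧
      ∃ r : ℝ, 0 ≤ r ∧ r < κ⁻¹ ∧ ∃ U ∈ 𝓝 xb, ∃ Us ∈ 𝓝 pb,
        ∀ x ∈ U, ∀ u ∈ U, ∀ q ∈ LimitingSubdiff f u, q ∈ Us →
          f u + ((⟪q, x - u⟫ - r / 2 * ‖x - u‖ ^ 2 : ℝ) : EReal) ≤ f x) ↔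
    ((∃ U ∈ 𝓝 xb, ∀ x ∈ U,
        f xb - ((⟪pb, xb⟫ : ℝ) : EReal) ≤ f x - ((⟪pb, x⟫ : ℝ) : EReal)) ∧
      StronglyMetricallyRegularAround (LimitingSubdiff f) xb pb κ) := by
  have hnear : ∀ U ∈ 𝓝 xb, ∃ x ∈ U, f x ≠ ⊤ := by
    intro U hU
    obtain ⟨xs, ps, h1, h2, -, -⟩ := hgph
    obtain ⟨k, hk⟩ := (h2.eventually hU).exists
    exact ⟨xs k, hk, (h1 k).1⟩
  have hepi := epi_closed f hbot hlsc
  have hsub := subgrad_mem f hbot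
  constructor
  · rintro ⟨hMR, r, hr, hrκ, U, hU, Us, hUs, hineq⟩
    have hxbU := mem_of_mem_nhds hU
    have hpbU := mem_of_mem_nhds hUs
    have hxbD : f xb ≠ ⊤ := by
      intro htop
      obtain ⟨x, hx, hxt⟩ := hnear U hU
      have := hineq x hx xb hxbU pb hgph hpbU
      rw [htop, EReal.top_add_coe, top_le_iff] at this
      exact hxt this
    have hrκ1 : r * κ < 1 := by rwa [← one_div, lt_div_iff₀ hκ] at hrκ
    obtain ⟨κ', hκκ', hrκ'⟩ : ∃ κ', κ < κ' ∧ r * κ' < 1 := by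
      have hp : 0 < (1 - r * κ) / (r + 1) := by
        have : 0 < 1 - r * κ := by linarith
        positivity
      refine ⟨κ + (1 - r * κ) / (r + 1), by linarith, ?_⟩
      have e : ((1 - r * κ) / (r + 1)) * (r + 1) = 1 - r * κ := by field_simp
      nlinarith
    have hκ'0 : 0 < κ' := hκ.trans hκκ'
    obtain ⟨ρA, hρA, haubin⟩ := aubin_of_regular _ xb pb κ κ' hκ hκκ' hMR
    have hyp : HypLoc {x | f x ≠ ⊤} (fun x => (f x).toReal) (LimitingSubdiff f) xb pb (-r) := by
      obtain ⟨a, ha, haU⟩ := Metric.mem_nhds_iff.1 hU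
      obtain ⟨b, hb, hbV⟩ := Metric.mem_nhds_iff.1 hUs
      refine ⟨min a b, by positivity, fun u q hu hq hqp => ?_⟩
      have hu' : u ∈ U := haU (by rw [mem_ball, dist_eq_norm]; exact hu.trans_le (min_le_left _ _))
      have hq' : q ∈ Us := hbV (by
        rw [mem_ball, dist_eq_norm]; exact hqp.trans_le (min_le_right _ _))
      have huD : f u ≠ ⊤ := by
        intro htop
        have := hineq xb hxbU u hu' q hq hq'
        rw [htop, EReal.top_add_coe, top_le_iff] at this
        exact hxbD this
      refine ⟨huD, fun x hx hxb => ?_⟩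
      have h1 := hineq x (haU (by
        rw [mem_ball, dist_eq_norm]; exact hxb.trans_le (min_le_left _ _))) u hu' q hq hq'
      rw [← EReal.coe_toReal huD (hbot _), ← EReal.coe_toReal hx (hbot _)] at h1
      norm_cast at h1
      linarith
    obtain ⟨β, hβ, ρ, hρ, hH⟩ := core1 _ _ _ hepi hsub xb pb κ' r ρA hκ'0 hr hrκ' hρA haubin hyp
    refine ⟨⟨ball xb ρ, ball_mem_nhds _ hρ, fun x hx => ?_⟩, hMR, ?_⟩
    · by_cases hxt : f x = ⊤
      · rw [hxt, EReal.top_sub_coe]; exact le_top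
      · rw [mem_ball, dist_eq_norm] at hx
        have h1 := (hH xb pb (by simpa using hρ) hgph (by simpa using hρ)).2 x hxt hx
        rw [← EReal.coe_toReal hxbD (hbot _), ← EReal.coe_toReal hxt (hbot _)]
        norm_cast
        have h2 : 0 ≤ β / 2 * ‖x - xb‖ ^ 2 := by positivity
        rw [inner_sub_right] at h1
        linarith
    · refine ⟨ball pb (min (min ρ ρA) (ρ / (κ' + 1))), ball_mem_nhds _ (by positivity),
        ball xb ρ, ball_mem_nhds _ hρ, fun y hy => ?_⟩
      rw [mem_ball, dist_eq_norm] at hy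
      have hy1 : ‖y - pb‖ < ρ := hy.trans_le ((min_le_left _ _).trans (min_le_left _ _))
      have hy2 : ‖y - pb‖ < ρA := hy.trans_le ((min_le_left _ _).trans (min_le_right _ _))
      have hy3 : ‖y - pb‖ * (κ' + 1) < ρ := by
        rw [← lt_div_iff₀ (by positivity)]; exact hy.trans_le (min_le_right _ _)
      obtain ⟨z, hz, hzx⟩ := haubin xb pb y (by simpa using hρA) hgph hy2
      refine ⟨z, ⟨?_, hz⟩, ?_⟩
      · rw [mem_ball, dist_eq_norm]
        nlinarith [norm_nonneg (y - pb)]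
      · rintro w ⟨hw, hwF⟩
        have hzb : ‖z - xb‖ < ρ := by nlinarith [norm_nonneg (y - pb)]
        rw [mem_ball, dist_eq_norm] at hw
        obtain ⟨hzD, h1⟩ := hH z y hzb hz hy1
        obtain ⟨hwD, h2⟩ := hH w y hw hwF hy1
        have h3 := h1 w hwD hw
        have h4 := h2 z hzD hzb
        have e : z - w = -(w - z) := by abel
        rw [e, norm_neg, inner_neg_right] at h4
        have h5 : β * ‖w - z‖ ^ 2 ≤ 0 := by linarith
        have h6 : ‖w - z‖ ^ 2 ≤ 0 := by
          by_contra hc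
          push Not at hc
          have := mul_pos hβ hc
          linarith
        have h7 : ‖w - z‖ = 0 := by
          have := le_antisymm h6 (sq_nonneg _)
          exact pow_eq_zero_iff (two_ne_zero) |>.1 this
        exact sub_eq_zero.1 (norm_eq_zero.1 h7)
  · rintro ⟨⟨U, hU, hmin⟩, hMR, V₁, hV₁, U₁, hU₁, huniq⟩
    have hxbD : f xb ≠ ⊤ := by
      intro htop
      obtain ⟨x, hx, hxt⟩ := hnear U hU
      have := hmin x hx
      rw [htop, EReal.top_sub_coe, top_le_iff, ← EReal.coe_toReal hxt (hbot _)] at this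
      rw [← EReal.coe_sub] at this
      exact EReal.coe_ne_top _ this
    refine ⟨hMR, 0, le_rfl, by positivity, ?_⟩
    obtain ⟨ρA, hρA, haubin⟩ := aubin_of_regular _ xb pb κ (κ + 1) hκ (by linarith) hMR
    obtain ⟨a, ha, haU⟩ := Metric.mem_nhds_iff.1 hU
    obtain ⟨b, hb, hbU⟩ := Metric.mem_nhds_iff.1 hU₁
    obtain ⟨c, hc, hcV⟩ := Metric.mem_nhds_iff.1 hV₁
    obtain ⟨ρ, hρ, h1, h2, h3, h4⟩ : ∃ ρ : ℝ, 0 < ρ ∧ ρ ≤ ρA ∧ ρ ≤ a ∧ ρ ≤ b ∧ ρ ≤ c :=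
      ⟨min (min ρA a) (min b c), by positivity, (min_le_left _ _).trans (min_le_left _ _),
        (min_le_left _ _).trans (min_le_right _ _), (min_le_right _ _).trans (min_le_left _ _),
        (min_le_right _ _).trans (min_le_right _ _)⟩
    obtain ⟨ρ', hρ', hH⟩ := core2 _ _ _ hepi hsub xb pb hxbD hgph (κ + 1) ρ (by positivity) hρ
      (fun x q y hx hq hy => haubin x q y (by linarith) hq (by linarith))
      (by
        intro x hx hxb
        have h5 := hmin x (haU (by rw [mem_ball, dist_eq_norm]; linarith))
        rw [← EReal.coe_toReal hxbD (hbot _), ← EReal.coe_toReal hx (hbot _)] at h5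
        norm_cast at h5
        rw [inner_sub_right]
        linarith)
      (by
        intro y x₁ x₂ hy hx₁ hx₂ hF₁ hF₂
        refine (huniq y (hcV ?_)).unique ⟨hbU ?_, hF₁⟩ ⟨hbU ?_, hF₂⟩ <;>
        · rw [mem_ball, dist_eq_norm]; linarith)
    refine ⟨ball xb ρ', ball_mem_nhds _ hρ', ball pb ρ', ball_mem_nhds _ hρ', ?_⟩
    intro x hx u hu q hq hqU
    rw [mem_ball, dist_eq_norm] at hx hu hqU
    obtain ⟨huD, h5⟩ := hH u q hu hq hqU
    by_cases hxt : f x = ⊤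
    · rw [hxt]; exact le_top
    have h6 := h5 x hxt hx
    rw [← EReal.coe_toReal huD (hbot _), ← EReal.coe_toReal hxt (hbot _)]
    norm_cast
    linarith
end
end

section
/- Define f : ℝ² → ℝ ∪ {+∞} by f(x₁, x₂) = x₁² + x₂² + δ_Ω(x₁, x₂) where Ω = {(x₁, x₂) ∈ ℝ² : x₁·x₂ = 0} and δ_Ω is the indicator function of Ω (equal to 0 on Ω and +∞ otherwise). Then the limiting subdifferential ∂f is metrically regular around ((0,0), (0,0)), but ∂f is not strongly metrically regular around ((0,0), (0,0)). -/
open Filter Metric Topology RealInnerProductSpace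

noncomputable section

/-- The Euclidean pairing on `ℝ × ℝ`. -/
def pairP (p q : ℝ × ℝ) : ℝ := p.1 * q.1 + p.2 * q.2

/-- The regular/Fréchet subdifferential of `f : ℝ × ℝ → EReal` at `x`. -/
def FrechetSubdiffP (f : ℝ × ℝ → EReal) (x : ℝ × ℝ) : Set (ℝ × ℝ) :=
  {p | f x ≠ ⊤ ∧ ∀ ε : ℝ, 0 < ε → ∃ δ : ℝ, 0 < δ ∧
    ∀ y : ℝ × ℝ, dist y x < δ →
      f x + ((pairP p (y - x) - ε * dist y x : ℝ) : EReal) ≤ f y}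

/-- The limiting subdifferential of `f : ℝ × ℝ → EReal` at `x`. -/
def LimitingSubdiffP (f : ℝ × ℝ → EReal) (x : ℝ × ℝ) : Set (ℝ × ℝ) :=
  {p | ∃ (xs ps : ℕ → ℝ × ℝ),
    (∀ k, ps k ∈ FrechetSubdiffP f (xs k)) ∧
    Tendsto xs atTop (𝓝 x) ∧
    Tendsto (fun k => f (xs k)) atTop (𝓝 (f x)) ∧
    Tendsto ps atTop (𝓝 p)}

/-- The function of Remark 4.8. -/
def crossFun : ℝ × ℝ → EReal := fun x =>
  if x.1 * x.2 = 0 then ((x.1 ^ 2 + x.2 ^ 2 : ℝ) : EReal) else ⊤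

lemma slope_aux (c δ : ℝ) (hδ : 0 < δ)
    (h : ∀ t : ℝ, |t| < δ → c * t ≤ t ^ 2 + |c| / 4 * |t|) : c = 0 := by
  by_contra hc
  have hc' : 0 < |c| := abs_pos.mpr hc
  obtain ⟨m, hm0, hm1, hm2⟩ : ∃ m : ℝ, 0 < m ∧ m < δ ∧ m ≤ |c| / 4 :=
    ⟨min (δ / 2) (|c| / 4), by positivity, by
      have := min_le_left (δ / 2) (|c| / 4); linarith, min_le_right _ _⟩
  rcases lt_or_gt_of_ne hc with h1 | h1
  · have := h (-m) (by rw [abs_neg, abs_of_pos hm0]; exact hm1)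
    rw [abs_neg, abs_of_pos hm0] at this
    rw [abs_of_neg h1] at *
    nlinarith
  · have := h m (by rw [abs_of_pos hm0]; exact hm1)
    rw [abs_of_pos hm0] at this
    rw [abs_of_pos h1] at *
    nlinarith

lemma frechet_nec {x p : ℝ × ℝ} (h : p ∈ FrechetSubdiffP crossFun x) :
    (x.2 = 0 ∧ p.1 = 2 * x.1) ∨ (x.1 = 0 ∧ p.2 = 2 * x.2) := by
  obtain ⟨a, b⟩ := x
  obtain ⟨p, q⟩ := p
  obtain ⟨hx, h⟩ := h
  have hab : a * b = 0 := by
    by_contra hab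
    exact hx (by simp only [crossFun]; rw [if_neg hab])
  rcases mul_eq_zero.mp hab with h0 | h0
  · right
    refine ⟨h0, ?_⟩
    subst h0
    by_contra hne
    have hc : 0 < |q - 2 * b| := abs_pos.mpr (sub_ne_zero.mpr hne)
    obtain ⟨δ, hδ, H⟩ := h (|q - 2 * b| / 4) (by positivity)
    refine hne (sub_eq_zero.mp (slope_aux _ δ hδ fun t ht => ?_))
    have hd : dist ((0 : ℝ), b + t) (0, b) = |t| := by
      simp [Prod.dist_eq, Real.dist_eq]
    have := H (0, b + t) (by rw [hd]; exact ht)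
    rw [hd] at this
    simp only [crossFun, zero_mul, if_true, pairP] at this
    rw [← EReal.coe_add, EReal.coe_le_coe_iff] at this
    simp at this
    nlinarith
  · left
    refine ⟨h0, ?_⟩
    subst h0
    by_contra hne
    have hc : 0 < |p - 2 * a| := abs_pos.mpr (sub_ne_zero.mpr hne)
    obtain ⟨δ, hδ, H⟩ := h (|p - 2 * a| / 4) (by positivity)
    refine hne (sub_eq_zero.mp (slope_aux _ δ hδ fun t ht => ?_))
    have hd : dist (a + t, (0 : ℝ)) (a, 0) = |t| := by
      simp [Prod.dist_eq, Real.dist_eq]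
    have := H (a + t, 0) (by rw [hd]; exact ht)
    rw [hd] at this
    simp only [crossFun, mul_zero, if_true, pairP] at this
    rw [← EReal.coe_add, EReal.coe_le_coe_iff] at this
    simp at this
    nlinarith

lemma frechet_suf1 (u t : ℝ) (hu : u ≠ 0) : (2 * u, t) ∈ FrechetSubdiffP crossFun (u, 0) := by
  refine ⟨by simp [crossFun, ← EReal.coe_pow], fun ε hε => ⟨|u|, abs_pos.mpr hu, ?_⟩⟩
  rintro ⟨y, z⟩ hy
  have h1 : |y - u| < |u| := lt_of_le_of_lt (le_max_left _ _) hy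
  have hy0 : y ≠ 0 := by rintro rfl; simp at h1
  by_cases hz : z = 0
  · subst hz
    simp only [crossFun, mul_zero, if_true, pairP]
    rw [← EReal.coe_add, EReal.coe_le_coe_iff]
    have : 0 ≤ ε * dist (y, (0 : ℝ)) (u, 0) := by positivity
    simp only [Prod.mk_sub_mk]
    nlinarith [sq_nonneg (y - u)]
  · have : crossFun (y, z) = ⊤ := by
      simp only [crossFun]; rw [if_neg (mul_ne_zero hy0 hz)]
    rw [this]; exact le_top

lemma frechet_suf2 (u t : ℝ) (hu : u ≠ 0) : (t, 2 * u) ∈ FrechetSubdiffP crossFun (0, u) := by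
  refine ⟨by simp [crossFun, ← EReal.coe_pow], fun ε hε => ⟨|u|, abs_pos.mpr hu, ?_⟩⟩
  rintro ⟨z, y⟩ hy
  have h1 : |y - u| < |u| := lt_of_le_of_lt (le_max_right _ _) hy
  have hy0 : y ≠ 0 := by rintro rfl; simp at h1
  by_cases hz : z = 0
  · subst hz
    simp only [crossFun, zero_mul, if_true, pairP]
    rw [← EReal.coe_add, EReal.coe_le_coe_iff]
    have : 0 ≤ ε * dist ((0 : ℝ), y) (0, u) := by positivity
    simp only [Prod.mk_sub_mk]
    nlinarith [sq_nonneg (y - u)]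
  · have : crossFun (z, y) = ⊤ := by
      simp only [crossFun]; rw [if_neg (mul_ne_zero hz hy0)]
    rw [this]; exact le_top

lemma exists_seq_ne (a : ℝ) : ∃ u : ℕ → ℝ, (∀ k, u k ≠ 0) ∧ Tendsto u atTop (𝓝 a) :=
  mem_closure_iff_seq_limit.mp ((dense_compl_singleton (0 : ℝ)) a)

lemma limiting_iff (x p : ℝ × ℝ) : p ∈ LimitingSubdiffP crossFun x ↔
    (x.2 = 0 ∧ p.1 = 2 * x.1) ∨ (x.1 = 0 ∧ p.2 = 2 * x.2) := by
  constructor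
  · rintro ⟨xs, ps, hps, hx, -, hp⟩
    have hcl : IsClosed {w : (ℝ × ℝ) × (ℝ × ℝ) |
        (w.1.2 = 0 ∧ w.2.1 = 2 * w.1.1) ∨ (w.1.1 = 0 ∧ w.2.2 = 2 * w.1.2)} := by
      apply IsClosed.union
      · exact (isClosed_eq (by fun_prop) (by fun_prop)).inter
          (isClosed_eq (by fun_prop) (by fun_prop))
      · exact (isClosed_eq (by fun_prop) (by fun_prop)).inter
          (isClosed_eq (by fun_prop) (by fun_prop))
    exact hcl.mem_of_tendsto (hx.prodMk_nhds hp)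
      (Eventually.of_forall fun k => frechet_nec (hps k))
  · obtain ⟨a, b⟩ := x
    obtain ⟨p, q⟩ := p
    rintro (⟨h1, h2⟩ | ⟨h1, h2⟩)
    · simp only at h1 h2
      subst h1 h2
      obtain ⟨u, hu, hlim⟩ := exists_seq_ne a
      refine ⟨fun k => (u k, 0), fun k => (2 * u k, q), fun k => frechet_suf1 _ _ (hu k),
        hlim.prodMk_nhds tendsto_const_nhds, ?_,
        (hlim.const_mul 2).prodMk_nhds tendsto_const_nhds⟩
      simp only [crossFun, mul_zero, if_true]
      exact (continuous_coe_real_ereal.tendsto _).comp ((hlim.pow 2).add_const _)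
    · simp only at h1 h2
      subst h1 h2
      obtain ⟨u, hu, hlim⟩ := exists_seq_ne b
      refine ⟨fun k => (0, u k), fun k => (p, 2 * u k), fun k => frechet_suf2 _ _ (hu k),
        tendsto_const_nhds.prodMk_nhds hlim, ?_,
        tendsto_const_nhds.prodMk_nhds (hlim.const_mul 2)⟩
      simp only [crossFun, zero_mul, if_true]
      exact (continuous_coe_real_ereal.tendsto _).comp ((hlim.pow 2).const_add _)

lemma lim_mem1 (y z : ℝ) : (y, z) ∈ LimitingSubdiffP crossFun (y / 2, 0) :=
  (limiting_iff _ _).mpr (Or.inl ⟨rfl, by show y = 2 * (y / 2); ring⟩)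

lemma lim_mem2 (y z : ℝ) : (y, z) ∈ LimitingSubdiffP crossFun (0, z / 2) :=
  (limiting_iff _ _).mpr (Or.inr ⟨rfl, by show z = 2 * (z / 2); ring⟩)

/-- Remark 4.8: the limiting subdifferential of `crossFun` is metrically regular but not
strongly metrically regular around the origin. -/
theorem metric_regularity_without_strong_regularity :
    (∃ κ : ℝ, 0 < κ ∧
      MetricallyRegularAround (LimitingSubdiffP crossFun) ((0, 0) : ℝ × ℝ) ((0, 0) : ℝ × ℝ) κ) ∧
    ¬ ∃ κ : ℝ, 0 < κ ∧
      StronglyMetricallyRegularAround (LimitingSubdiffP crossFun)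
        ((0, 0) : ℝ × ℝ) ((0, 0) : ℝ × ℝ) κ := by
  constructor
  · refine ⟨1, one_pos, Set.univ, univ_mem, Set.univ, univ_mem, ?_⟩
    rintro ⟨a, b⟩ - ⟨y, z⟩ -
    rw [ENNReal.ofReal_one, one_mul]
    refine Metric.le_infEDist.mpr ?_
    rintro ⟨p, q⟩ hpq
    rcases (limiting_iff _ _).mp hpq with ⟨h1, h2⟩ | ⟨h1, h2⟩
    · simp only at h1 h2
      subst h1 h2
      have hm : ((y / 2, 0) : ℝ × ℝ) ∈ {w | (y, z) ∈ LimitingSubdiffP crossFun w} :=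
        lim_mem1 y z
      refine (Metric.infEDist_le_edist_of_mem hm).trans ?_
      rw [edist_dist, edist_dist]
      apply ENNReal.ofReal_le_ofReal
      refine le_trans ?_ (le_max_left _ _)
      simp only [Prod.dist_eq, Real.dist_eq, sub_self, abs_zero]
      refine max_le ?_ (abs_nonneg _)
      rw [show a - y / 2 = -((y - 2 * a) / 2) by ring, abs_neg, abs_div, abs_two]
      linarith [abs_nonneg (y - 2 * a)]
    · simp only at h1 h2
      subst h1 h2
      have hm : ((0, z / 2) : ℝ × ℝ) ∈ {w | (y, z) ∈ LimitingSubdiffP crossFun w} :=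
        lim_mem2 y z
      refine (Metric.infEDist_le_edist_of_mem hm).trans ?_
      rw [edist_dist, edist_dist]
      apply ENNReal.ofReal_le_ofReal
      refine le_trans ?_ (le_max_right _ _)
      simp only [Prod.dist_eq, Real.dist_eq, sub_self, abs_zero]
      refine max_le (abs_nonneg _) ?_
      rw [show b - z / 2 = -((z - 2 * b) / 2) by ring, abs_neg, abs_div, abs_two]
      linarith [abs_nonneg (z - 2 * b)]
  · rintro ⟨κ, -, -, V, hV, U, hU, H⟩
    have e1 : ∀ᶠ t : ℝ in 𝓝 0, ((t, t) : ℝ × ℝ) ∈ V :=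
      (show Continuous fun t : ℝ => (t, t) by fun_prop).tendsto' 0 (0, 0) rfl hV
    have e2 : ∀ᶠ t : ℝ in 𝓝 0, ((t / 2, 0) : ℝ × ℝ) ∈ U :=
      (show Continuous fun t : ℝ => (t / 2, (0 : ℝ)) by fun_prop).tendsto' 0 (0, 0) (by simp) hU
    have e3 : ∀ᶠ t : ℝ in 𝓝 0, ((0, t / 2) : ℝ × ℝ) ∈ U :=
      (show Continuous fun t : ℝ => ((0 : ℝ), t / 2) by fun_prop).tendsto' 0 (0, 0) (by simp) hU
    obtain ⟨δ, hδ, hball⟩ := Metric.eventually_nhds_iff.mp (e1.and (e2.and e3))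
    obtain ⟨h1, h2, h3⟩ := hball (y := δ / 2) (by
      rw [Real.dist_eq, sub_zero, abs_of_pos (by positivity)]; linarith)
    have := (H _ h1).unique ⟨h2, lim_mem1 _ _⟩
      ⟨h3, lim_mem2 _ _⟩
    have := congrArg Prod.fst this
    simp only at this
    linarith
end
end

section
/- Let X be a Hilbert space and let f : X → ℝ ∪ {+∞} be a proper lower semicontinuous function that is both prox-regular and subdifferentially continuous at x̄ for x̄* = 0 ∈ ∂f(x̄). If x̄ is a tilt-stable local minimizer of f with modulus κ > 0, then there exists η > 0 such that for every r ∈ [0, κ⁻¹) one has κ‖u*‖ ≥ ‖u‖ and ⟨u*, u⟩ ≥ −r‖u‖² (indeed ⟨u*, u⟩ ≥ κ⁻¹‖u‖²) whenever u* ∈ ∂̆²f(x, x*)(u) with (x, x*) ∈ gph ∂f ∩ B_η(x̄, 0). -/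
open Filter Metric Topology RealInnerProductSpace

noncomputable section

variable {X : Type*} [NormedAddCommGroup X] [InnerProductSpace ℝ X]

/-- `f` is subdifferentially continuous at `xb` for `pb`: the map `(x, p) ↦ f x` is
continuous at `(xb, pb)` relative to the graph of the limiting subdifferential. -/
def SubdiffContAt (f : X → EReal) (xb pb : X) : Prop :=
  Tendsto (fun q : X × X => f q.1)
    (𝓝[{q : X × X | q.2 ∈ LimitingSubdiff f q.1}] (xb, pb)) (𝓝 (f xb))

/-- `f` is prox-regular at `xb` for `pb`. -/
def ProxRegularAt (f : X → EReal) (xb pb : X) : Prop :=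
  f xb ≠ ⊤ ∧ ∃ r : ℝ, 0 < r ∧ ∃ ε : ℝ, 0 < ε ∧
    ∀ x ∈ Metric.closedBall xb ε, ∀ u ∈ Metric.closedBall xb ε,
      f u ≤ f xb + (ε : EReal) → f xb ≤ f u + (ε : EReal) →
      ∀ p ∈ LimitingSubdiff f u, p ∈ Metric.closedBall pb ε →
        f u + ((⟪p, x - u⟫ - r / 2 * ‖x - u‖ ^ 2 : ℝ) : EReal) ≤ f x

/-- The set of minimizers of the tilted function `x ↦ f x - ⟪p, x⟫` over the
closed ball of radius `γ` around `xb`. -/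
def TiltArgmin (f : X → EReal) (xb : X) (γ : ℝ) (p : X) : Set X :=
  {x | x ∈ Metric.closedBall xb γ ∧ ∀ y ∈ Metric.closedBall xb γ,
    f x - ((⟪p, x⟫ : ℝ) : EReal) ≤ f y - ((⟪p, y⟫ : ℝ) : EReal)}

/-- `xb` is a tilt-stable local minimizer of `f` with modulus `κ`. -/
def TiltStableWith (f : X → EReal) (xb : X) (κ : ℝ) : Prop :=
  ∃ γ : ℝ, 0 < γ ∧ ∃ V ∈ 𝓝 (0 : X), ∃ m : X → X,
    (∀ p ∈ V, TiltArgmin f xb γ p = {m p}) ∧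
    LipschitzOnWith (Real.toNNReal κ) m V ∧ m 0 = xb

/-- `xb` is a tilt-stable local minimizer of `f`. -/
def TiltStable (f : X → EReal) (xb : X) : Prop :=
  ∃ γ : ℝ, 0 < γ ∧ ∃ V ∈ 𝓝 (0 : X), ∃ m : X → X, ∃ K : NNReal,
    (∀ p ∈ V, TiltArgmin f xb γ p = {m p}) ∧
    LipschitzOnWith K m V ∧ m 0 = xb

/-- The Fréchet/regular normal cone to a subset of `X × X` at a point. -/
def FrechetNormalP (Ω : Set (X × X)) (zb : X × X) : Set (X × X) :=
  {w | ∀ ε : ℝ, 0 < ε → ∃ δ : ℝ, 0 < δ ∧ ∀ z ∈ Ω, dist z zb < δ →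
    ⟪w.1, z.1 - zb.1⟫ + ⟪w.2, z.2 - zb.2⟫ ≤ ε * dist z zb}

/-- The combined second-order subdifferential of `f` at `x` for `p ∈ ∂f(x)`:
the regular coderivative of the limiting subdifferential mapping. -/
def CombinedSecondSubdiff (f : X → EReal) (x p u : X) : Set X :=
  {w | (w, -u) ∈ FrechetNormalP {q : X × X | q.2 ∈ LimitingSubdiff f q.1} (x, p)}

section Helpers

variable {E : Type*} [NormedAddCommGroup E] [InnerProductSpace ℝ E]

/-- Descent lemma with constants improving by bisection. -/
lemma descent_aux (h : E → ℝ) (m : E → E) (κ R : ℝ)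
    (hsub : ∀ p ∈ ball (0 : E) R, ∀ q ∈ ball (0 : E) R, h p + ⟪m p, q - p⟫ ≤ h q)
    (hlip : ∀ p ∈ ball (0 : E) R, ∀ q ∈ ball (0 : E) R, ‖m q - m p‖ ≤ κ * ‖q - p‖) (n : ℕ) :
    ∀ p ∈ ball (0 : E) R, ∀ q ∈ ball (0 : E) R,
      h q ≤ h p + ⟪m p, q - p⟫ + (κ / 2 + κ / 2 * (1 / 2) ^ n) * ‖q - p‖ ^ 2 := by
  have hstep : ∀ p ∈ ball (0 : E) R, ∀ q ∈ ball (0 : E) R, ∀ d : E,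
      ⟪m q - m p, d⟫ ≤ κ * ‖q - p‖ * ‖d‖ := fun p hp q hq d =>
    (real_inner_le_norm _ _).trans
      (mul_le_mul_of_nonneg_right (hlip p hp q hq) (norm_nonneg _))
  induction n with
  | zero =>
    intro p hp q hq
    have h1 := hsub q hq p hp
    have h2 := hstep p hp q hq (q - p)
    have h3 : ⟪m q, p - q⟫ = -⟪m q, q - p⟫ := by rw [← inner_neg_right, neg_sub]
    rw [inner_sub_left] at h2
    simp only [pow_zero]
    nlinarith
  | succ n ih =>
    intro p hp q hq
    set c : E := (1 / 2 : ℝ) • p + (1 / 2 : ℝ) • q with hc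
    have hcm : c ∈ ball (0 : E) R :=
      (convex_ball (0 : E) R) hp hq (by norm_num) (by norm_num) (by norm_num)
    have e1 : c - p = (1 / 2 : ℝ) • (q - p) := by rw [hc]; module
    have e2 : q - c = (1 / 2 : ℝ) • (q - p) := by rw [hc]; module
    have n1 : ‖(1 / 2 : ℝ) • (q - p)‖ = 1 / 2 * ‖q - p‖ := by
      rw [norm_smul]; norm_num
    have i1 := ih p hp c hcm
    have i2 := ih c hcm q hq
    have i3 := hstep p hp c hcm ((1 / 2 : ℝ) • (q - p))
    rw [e1] at i1 i3
    rw [e2] at i2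
    rw [n1] at i1 i2 i3
    rw [inner_sub_left] at i3
    simp only [inner_smul_right] at i1 i2 i3
    rw [pow_succ]
    nlinarith

lemma descent (h : E → ℝ) (m : E → E) (κ R : ℝ)
    (hsub : ∀ p ∈ ball (0 : E) R, ∀ q ∈ ball (0 : E) R, h p + ⟪m p, q - p⟫ ≤ h q)
    (hlip : ∀ p ∈ ball (0 : E) R, ∀ q ∈ ball (0 : E) R, ‖m q - m p‖ ≤ κ * ‖q - p‖)
    (p : E) (hp : p ∈ ball (0 : E) R) (q : E) (hq : q ∈ ball (0 : E) R) :
    h q ≤ h p + ⟪m p, q - p⟫ + κ / 2 * ‖q - p‖ ^ 2 := by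
  have t : Tendsto (fun n : ℕ => h p + ⟪m p, q - p⟫ +
      (κ / 2 + κ / 2 * (1 / 2 : ℝ) ^ n) * ‖q - p‖ ^ 2) atTop
      (𝓝 (h p + ⟪m p, q - p⟫ + (κ / 2 + κ / 2 * 0) * ‖q - p‖ ^ 2)) := by
    have := tendsto_pow_atTop_nhds_zero_of_lt_one (r := (1 / 2 : ℝ)) (by norm_num) (by norm_num)
    exact tendsto_const_nhds.add ((tendsto_const_nhds.add (this.const_mul _)).mul_const _)
  have := ge_of_tendsto' t (fun n => descent_aux h m κ R hsub hlip n p hp q hq)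
  simpa using this

/-- Local Baillon-Haddad theorem. -/
lemma cocoercive (h : E → ℝ) (m : E → E) (κ R : ℝ) (hκ : 0 < κ)
    (hsub : ∀ p ∈ ball (0 : E) R, ∀ q ∈ ball (0 : E) R, h p + ⟪m p, q - p⟫ ≤ h q)
    (hlip : ∀ p ∈ ball (0 : E) R, ∀ q ∈ ball (0 : E) R, ‖m q - m p‖ ≤ κ * ‖q - p‖)
    (p : E) (hp : p ∈ ball (0 : E) (R / 3)) (q : E) (hq : q ∈ ball (0 : E) (R / 3)) :
    ‖m q - m p‖ ^ 2 ≤ κ * ⟪m q - m p, q - p⟫ := by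
  have key : ∀ p ∈ ball (0 : E) (R / 3), ∀ q ∈ ball (0 : E) (R / 3),
      κ⁻¹ / 2 * ‖m q - m p‖ ^ 2 ≤ h q - h p - ⟪m p, q - p⟫ := by
    intro p hp q hq
    rw [mem_ball_zero_iff] at hp hq
    have hR : 0 < R := by have := norm_nonneg p; linarith
    have hp' : p ∈ ball (0 : E) R := by rw [mem_ball_zero_iff]; linarith
    have hq' : q ∈ ball (0 : E) R := by rw [mem_ball_zero_iff]; linarith
    set z := q + κ⁻¹ • (m p - m q) with hz
    have hzq : z - q = κ⁻¹ • (m p - m q) := by rw [hz]; abel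
    have nzq : ‖z - q‖ = κ⁻¹ * ‖m q - m p‖ := by
      rw [hzq, norm_smul, Real.norm_of_nonneg (by positivity), norm_sub_rev]
    have hle : ‖z - q‖ ≤ ‖q - p‖ := by
      rw [nzq, inv_mul_le_iff₀ hκ]; exact hlip p hp' q hq'
    have hz' : z ∈ ball (0 : E) R := by
      rw [mem_ball_zero_iff]
      have a1 : ‖z‖ ≤ ‖z - q‖ + ‖q‖ := by simpa using norm_add_le (z - q) q
      have a2 := norm_sub_le q p
      linarith
    have b1 := hsub p hp' z hz'
    have b2 := descent h m κ R hsub hlip q hq' z hz'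
    have b3 : ⟪m p, z - p⟫ = ⟪m p, z - q⟫ + ⟪m p, q - p⟫ := by
      rw [← inner_add_right]; congr 1; abel
    have b4 : ⟪m p, z - q⟫ - ⟪m q, z - q⟫ = κ⁻¹ * ‖m q - m p‖ ^ 2 := by
      rw [← inner_sub_left, hzq, inner_smul_right, real_inner_self_eq_norm_sq, norm_sub_rev]
    rw [nzq] at b2
    have b5 : κ / 2 * (κ⁻¹ * ‖m q - m p‖) ^ 2 = κ⁻¹ / 2 * ‖m q - m p‖ ^ 2 := by
      field_simp
    linarith
  have k1 := key p hp q hq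
  have k2 := key q hq p hp
  rw [norm_sub_rev] at k2
  have e : ⟪m q, p - q⟫ = -⟪m q, q - p⟫ := by rw [← inner_neg_right, neg_sub]
  have : κ⁻¹ * ‖m q - m p‖ ^ 2 ≤ ⟪m q - m p, q - p⟫ := by
    rw [inner_sub_left]; linarith
  rwa [inv_mul_le_iff₀ hκ] at this

/-- Reflected form of cocoercivity. -/
lemma reflect (a d : E) (κ : ℝ) (hκ : 0 < κ) (h : ‖a‖ ^ 2 ≤ κ * ⟪a, d⟫) :
    ‖a - (κ / 2) • d‖ ≤ κ / 2 * ‖d‖ := by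
  apply le_of_sq_le_sq _ (by positivity)
  rw [norm_sub_sq_real, inner_smul_right, norm_smul, Real.norm_of_nonneg (by positivity)]
  nlinarith

lemma surj_aux [CompleteSpace E] (m : E → E) (κ s ρ : ℝ) (hκ : 0 < κ) (hs : 0 < s) (hρ : 0 < ρ)
    (hco : ∀ p ∈ closedBall (0 : E) ρ, ∀ q ∈ closedBall (0 : E) ρ,
      ‖m q - m p‖ ^ 2 ≤ κ * ⟪m q - m p, q - p⟫)
    (q : E) (hq : ‖q - s • m 0‖ ≤ ρ) : ∃ p ∈ closedBall (0 : E) ρ, p + s • m p = q := by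
  set a : ℝ := s * κ / 2 with ha
  have hapos : 0 < a := by positivity
  let T : E → E := fun p => (1 + a)⁻¹ • (q - s • (m p - (κ / 2) • p))
  have hT : ∀ p ∈ closedBall (0 : E) ρ, ∀ p' ∈ closedBall (0 : E) ρ,
      ‖T p' - T p‖ ≤ (1 + a)⁻¹ * (a * ‖p' - p‖) := by
    intro p hp p' hp'
    have e : T p' - T p = (1 + a)⁻¹ • (-s • ((m p' - m p) - (κ / 2) • (p' - p))) := by
      simp only [T]; module
    rw [e, norm_smul, norm_smul, Real.norm_of_nonneg (by positivity), norm_neg,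
      Real.norm_of_nonneg hs.le]
    have := reflect (m p' - m p) (p' - p) κ hκ (hco p hp p' hp')
    apply mul_le_mul_of_nonneg_left _ (by positivity)
    calc s * _ ≤ s * (κ / 2 * ‖p' - p‖) := mul_le_mul_of_nonneg_left this hs.le
      _ = a * ‖p' - p‖ := by rw [ha]; ring
  have h0 : (0 : E) ∈ closedBall (0 : E) ρ := by simp [hρ.le]
  have hT0 : ‖T 0‖ ≤ (1 + a)⁻¹ * ρ := by
    simp only [T, smul_zero, sub_zero]
    rw [norm_smul, Real.norm_of_nonneg (by positivity)]
    exact mul_le_mul_of_nonneg_left hq (by positivity)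
  have hmaps : Set.MapsTo T (closedBall 0 ρ) (closedBall 0 ρ) := by
    intro p hp
    have h1 := hT 0 h0 p hp
    rw [sub_zero] at h1
    rw [mem_closedBall_zero_iff] at hp ⊢
    have h2 : ‖T p‖ ≤ ‖T p - T 0‖ + ‖T 0‖ := by simpa using norm_add_le (T p - T 0) (T 0)
    have h3 : (1 + a)⁻¹ * (a * ‖p‖) ≤ (1 + a)⁻¹ * (a * ρ) := by gcongr
    have h4 : (1 + a)⁻¹ * (a * ρ) + (1 + a)⁻¹ * ρ = ρ := by field_simp; ring
    linarith
  have hc : (1 + a)⁻¹ * a < 1 := by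
    rw [inv_mul_lt_iff₀ (by positivity)]; linarith
  have hcontr : ContractingWith ((1 + a)⁻¹ * a).toNNReal (hmaps.restrict T _ _) := by
    refine ⟨by rw [Real.toNNReal_lt_one]; exact hc, ?_⟩
    apply LipschitzWith.of_dist_le_mul
    rintro ⟨x, hx⟩ ⟨y, hy⟩
    rw [Real.coe_toNNReal _ (by positivity), Subtype.dist_eq, Subtype.dist_eq, dist_eq_norm,
      dist_eq_norm, mul_assoc]
    exact hT y hy x hx
  obtain ⟨p, hp, hfix, -⟩ := hcontr.exists_fixedPoint' (isClosed_closedBall.isComplete) hmaps h0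
    (edist_ne_top _ _)
  refine ⟨p, hp, ?_⟩
  have h1 : (1 + a)⁻¹ • (q - s • (m p - (κ / 2) • p)) = p := hfix
  have h2 : q - s • (m p - (κ / 2) • p) = (1 + a) • p := by
    rw [inv_smul_eq_iff₀ (by positivity)] at h1; exact h1
  have h3 : q = (1 + a) • p + s • (m p - (κ / 2) • p) := by rw [← h2]; abel
  rw [h3, ha]; module

lemma normal_final (G : Set (E × E)) (m : E → E) (κ ρ : ℝ) (hκ : 0 < κ)
    (hG : ∀ p ∈ closedBall (0 : E) ρ, (m p, p) ∈ G)
    (hlip : ∀ p ∈ closedBall (0 : E) ρ, ∀ q ∈ closedBall (0 : E) ρ, ‖m q - m p‖ ≤ κ * ‖q - p‖)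
    (hco : ∀ p ∈ closedBall (0 : E) ρ, ∀ q ∈ closedBall (0 : E) ρ,
      ‖m q - m p‖ ^ 2 ≤ κ * ⟪m q - m p, q - p⟫)
    (p : E) (hp : ‖p‖ < ρ) (u w : E) (hw : (w, -u) ∈ FrechetNormalP G (m p, p)) :
    ‖u‖ ^ 2 ≤ κ * ⟪w, u⟫ := by
  set v : E := (κ / 2) • w - u with hv
  have hpm : p ∈ closedBall (0 : E) ρ := by rw [mem_closedBall_zero_iff]; exact hp.le
  suffices hmain : ‖v‖ ≤ κ / 2 * ‖w‖ by
    have h1 : ‖v‖ ^ 2 ≤ (κ / 2 * ‖w‖) ^ 2 := pow_le_pow_left₀ (norm_nonneg _) hmain 2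
    rw [hv, norm_sub_sq_real, inner_smul_left, norm_smul,
      Real.norm_of_nonneg (by positivity)] at h1
    simp only [conj_trivial] at h1
    linarith
  apply le_of_forall_pos_le_add
  intro e he
  by_cases hv0 : v = 0
  · rw [hv0, norm_zero]; positivity
  have hvpos : 0 < ‖v‖ := norm_pos_iff.2 hv0
  obtain ⟨δ, hδ, H⟩ := hw (e / (1 + κ)) (by positivity)
  obtain ⟨t, ht, ht1, ht2⟩ : ∃ t : ℝ, 0 < t ∧ t * ‖v‖ ≤ ρ - ‖p‖ ∧ (1 + κ) * (t * ‖v‖) < δ := by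
    refine ⟨min (ρ - ‖p‖) (δ / (2 * (1 + κ))) / ‖v‖, ?_, ?_, ?_⟩
    · have : 0 < ρ - ‖p‖ := by linarith
      positivity
    · rw [div_mul_cancel₀ _ hvpos.ne']; exact min_le_left _ _
    · rw [div_mul_cancel₀ _ hvpos.ne']
      calc (1 + κ) * _ ≤ (1 + κ) * (δ / (2 * (1 + κ))) := by gcongr; exact min_le_right _ _
        _ = δ / 2 := by field_simp
        _ < δ := by linarith
  have hn : ‖t • v‖ = t * ‖v‖ := by rw [norm_smul, Real.norm_of_nonneg ht.le]
  have hp' : p + t • v ∈ closedBall (0 : E) ρ := by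
    rw [mem_closedBall_zero_iff]
    have := norm_add_le p (t • v)
    linarith
  have hsub : p + t • v - p = t • v := by abel
  have hl := hlip p hpm _ hp'
  have hr := reflect _ _ κ hκ (hco p hpm _ hp')
  rw [hsub, hn] at hl hr
  have hd : dist ((m (p + t • v), p + t • v) : E × E) (m p, p) ≤ (1 + κ) * (t * ‖v‖) := by
    rw [Prod.dist_eq]
    have hpos : 0 ≤ t * ‖v‖ := by positivity
    apply max_le
    · simp only [dist_eq_norm]; linarith
    · simp only [dist_eq_norm, hsub, hn]; nlinarith
  have hH := H _ (hG _ hp') (lt_of_le_of_lt hd ht2)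
  simp only [hsub] at hH
  have hH2 : e / (1 + κ) * dist ((m (p + t • v), p + t • v) : E × E) (m p, p) ≤ e * (t * ‖v‖) := by
    calc _ ≤ e / (1 + κ) * ((1 + κ) * (t * ‖v‖)) := by gcongr
      _ = _ := by field_simp
  set D := m (p + t • v) - m p with hD
  have hi : -(‖w‖ * (κ / 2 * (t * ‖v‖))) ≤ ⟪w, D - (κ / 2) • t • v⟫ := by
    have := abs_real_inner_le_norm w (D - (κ / 2) • t • v)
    have h2 : ‖w‖ * ‖D - (κ / 2) • t • v‖ ≤ ‖w‖ * (κ / 2 * (t * ‖v‖)) := by gcongr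
    have := (abs_le.1 (this.trans h2)).1
    exact this
  have hvv : ‖v‖ ^ 2 = κ / 2 * ⟪w, v⟫ - ⟪u, v⟫ := by
    rw [← real_inner_self_eq_norm_sq]
    nth_rewrite 1 [hv]
    rw [inner_sub_left, inner_smul_left]; simp
  rw [inner_sub_right] at hi
  simp only [inner_smul_right, inner_neg_left] at hi hH
  have hfin : (t * ‖v‖) * ‖v‖ ≤ (t * ‖v‖) * (κ / 2 * ‖w‖ + e) := by
    have : (t * ‖v‖) * ‖v‖ = t * (κ / 2 * ⟪w, v⟫ - ⟪u, v⟫) := by rw [← hvv]; ring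
    rw [this]
    nlinarith
  exact le_of_mul_le_mul_left hfin (by positivity)

end Helpers

/-- Theorem 4.9, (i) ⟹ (ii): tilt stability with modulus `κ` implies the uniform
second-order conditions on the combined second-order subdifferential. -/
theorem tilt_stability_implies_second_order_conditions {X : Type*} [NormedAddCommGroup X] [InnerProductSpace ℝ X] [CompleteSpace X]
    (f : X → EReal)
    (hproper : ∃ x, f x ≠ ⊤) (hbot : ∀ x, f x ≠ ⊥) (hlsc : LowerSemicontinuous f)
    (xb : X) (h0 : (0 : X) ∈ LimitingSubdiff f xb)
    (hpr : ProxRegularAt f xb 0) (hsc : SubdiffContAt f xb 0)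
    (κ : ℝ) (hκ : 0 < κ) (htilt : TiltStableWith f xb κ) :
    ∃ η : ℝ, 0 < η ∧ ∀ r : ℝ, 0 ≤ r → r < κ⁻¹ →
      ∀ x p : X, p ∈ LimitingSubdiff f x → (x, p) ∈ Metric.closedBall (xb, (0 : X)) η →
        ∀ u w : X, w ∈ CombinedSecondSubdiff f x p u →
          ‖u‖ ≤ κ * ‖w‖ ∧ -r * ‖u‖ ^ 2 ≤ ⟪w, u⟫ ∧ κ⁻¹ * ‖u‖ ^ 2 ≤ ⟪w, u⟫ := by
  obtain ⟨γ, hγ, V, hV, m, hm, hmlip, hm0⟩ := htilt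
  obtain ⟨hfxb, r, hr, ε, hε, hprox⟩ := hpr
  obtain ⟨R, hR, hRV⟩ := Metric.mem_nhds_iff.1 hV
  have hlip : ∀ p ∈ ball (0 : X) R, ∀ q ∈ ball (0 : X) R, ‖m q - m p‖ ≤ κ * ‖q - p‖ := by
    intro p hp q hq
    have := hmlip.dist_le_mul q (hRV hq) p (hRV hp)
    rwa [Real.coe_toNNReal _ hκ.le, dist_eq_norm, dist_eq_norm] at this
  have hmin : ∀ p ∈ ball (0 : X) R, m p ∈ TiltArgmin f xb γ p := fun p hp => by
    rw [hm p (hRV hp)]; rfl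
  have hfin : ∀ p ∈ ball (0 : X) R, f (m p) ≠ ⊤ := by
    intro p hp htop
    have h1 := (hmin p hp).2 xb (by simp [hγ.le])
    rw [htop] at h1
    lift f xb to ℝ using ⟨hfxb, hbot xb⟩ with a
    rw [EReal.top_sub_coe, ← EReal.coe_sub] at h1
    exact EReal.coe_ne_top _ (top_le_iff.1 h1)
  have hsub : ∀ p ∈ ball (0 : X) R, ∀ q ∈ ball (0 : X) R,
      (⟪p, m p⟫ - (f (m p)).toReal) + ⟪m p, q - p⟫ ≤ ⟪q, m q⟫ - (f (m q)).toReal := by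
    intro p hp q hq
    have h1 := (hmin q hq).2 (m p) (hmin p hp).1
    rw [← EReal.coe_toReal (hfin p hp) (hbot _), ← EReal.coe_toReal (hfin q hq) (hbot _),
      ← EReal.coe_sub, ← EReal.coe_sub, EReal.coe_le_coe_iff] at h1
    rw [inner_sub_right, real_inner_comm q (m p), real_inner_comm p (m p)]
    linarith
  have hco := cocoercive (fun p => ⟪p, m p⟫ - (f (m p)).toReal) m κ R hκ hsub hlip
  have hmxb : ∀ p ∈ ball (0 : X) R, ‖m p - xb‖ ≤ κ * ‖p‖ := by
    intro p hp
    have := hlip 0 (by simp [hR]) p hp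
    rwa [hm0, sub_zero] at this
  have hgr : ∀ p ∈ ball (0 : X) R, κ * ‖p‖ < γ → p ∈ LimitingSubdiff f (m p) := by
    intro p hp hpγ
    have hF : p ∈ FrechetSubdiff f (m p) := by
      refine ⟨hfin p hp, fun e he => ⟨γ - κ * ‖p‖, by linarith, fun y hy => ?_⟩⟩
      have hyB : y ∈ closedBall xb γ := by
        rw [mem_closedBall, dist_eq_norm]
        have h1 := hmxb p hp
        have h2 : ‖y - xb‖ ≤ ‖y - m p‖ + ‖m p - xb‖ := norm_sub_le_norm_sub_add_norm_sub _ _ _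
        linarith
      have h1 := (hmin p hp).2 y hyB
      by_cases hy' : f y = ⊤
      · rw [hy']; exact le_top
      rw [← EReal.coe_toReal (hfin p hp) (hbot _), ← EReal.coe_toReal hy' (hbot _)] at h1 ⊢
      rw [← EReal.coe_sub, ← EReal.coe_sub, EReal.coe_le_coe_iff] at h1
      rw [← EReal.coe_add, EReal.coe_le_coe_iff, inner_sub_right]
      have : 0 ≤ e * ‖y - m p‖ := by positivity
      linarith
    exact ⟨fun _ => m p, fun _ => p, fun _ => hF, tendsto_const_nhds, tendsto_const_nhds,
      fun _ => tendsto_const_nhds⟩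
  -- subdifferential continuity
  obtain ⟨η₀, hη₀, hscη⟩ : ∃ η₀ : ℝ, 0 < η₀ ∧ ∀ x p : X, ‖x - xb‖ < η₀ → ‖p‖ < η₀ →
      p ∈ LimitingSubdiff f x → f x ≤ f xb + (ε : EReal) ∧ f xb ≤ f x + (ε : EReal) := by
    have hev : ∀ᶠ y in 𝓝 (f xb), y ≤ f xb + (ε : EReal) ∧ f xb ≤ y + (ε : EReal) := by
      lift f xb to ℝ using ⟨hfxb, hbot xb⟩ with a
      have h1 : ((a - ε : ℝ) : EReal) < a := by rw [EReal.coe_lt_coe_iff]; linarith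
      have h2 : (a : EReal) < ((a + ε : ℝ) : EReal) := by rw [EReal.coe_lt_coe_iff]; linarith
      filter_upwards [lt_mem_nhds h1, gt_mem_nhds h2] with y hy1 hy2
      refine ⟨by rw [← EReal.coe_add]; exact hy2.le, ?_⟩
      calc (a : EReal) = ((a - ε : ℝ) : EReal) + (ε : EReal) := by
            rw [← EReal.coe_add]; norm_num
        _ ≤ y + (ε : EReal) := by gcongr
    have hev2 := hsc.eventually hev
    rw [eventually_nhdsWithin_iff, Metric.eventually_nhds_iff] at hev2
    obtain ⟨η₀, hη₀, H⟩ := hev2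
    refine ⟨η₀, hη₀, fun x p hx hp hxp => ?_⟩
    refine H (y := (x, p)) ?_ hxp
    rw [Prod.dist_eq]
    simp only [dist_eq_norm, sub_zero]
    exact max_lt hx hp
  set s : ℝ := r + 1 with hs
  have hspos : 0 < s := by positivity
  -- hypomonotonicity
  have hypo : ∀ x p x' p' : X, ‖x - xb‖ < η₀ → ‖p‖ < η₀ → ‖x - xb‖ ≤ ε → ‖p‖ ≤ ε →
      p ∈ LimitingSubdiff f x → ‖x' - xb‖ < η₀ → ‖p'‖ < η₀ → ‖x' - xb‖ ≤ ε → ‖p'‖ ≤ ε →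
      p' ∈ LimitingSubdiff f x' → ⟪p - p', x' - x⟫ ≤ r * ‖x' - x‖ ^ 2 := by
    intro x p x' p' a1 a2 a3 a4 a5 b1 b2 b3 b4 b5
    obtain ⟨c1, c2⟩ := hscη x p a1 a2 a5
    obtain ⟨d1, d2⟩ := hscη x' p' b1 b2 b5
    have hx : x ∈ closedBall xb ε := by rwa [mem_closedBall, dist_eq_norm]
    have hx' : x' ∈ closedBall xb ε := by rwa [mem_closedBall, dist_eq_norm]
    have e1 := hprox x' hx' x hx c1 c2 p a5 (by rwa [mem_closedBall_zero_iff])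
    have e2 := hprox x hx x' hx' d1 d2 p' b5 (by rwa [mem_closedBall_zero_iff])
    have hlt : f xb + (ε : EReal) < ⊤ := EReal.add_lt_top hfxb (EReal.coe_ne_top _)
    have t1 : f x ≠ ⊤ := (c1.trans_lt hlt).ne
    have t2 : f x' ≠ ⊤ := (d1.trans_lt hlt).ne
    rw [← EReal.coe_toReal t1 (hbot _), ← EReal.coe_toReal t2 (hbot _), ← EReal.coe_add,
      EReal.coe_le_coe_iff] at e1 e2
    have e3 : ⟪p', x - x'⟫ = -⟪p', x' - x⟫ := by rw [← inner_neg_right, neg_sub]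
    rw [norm_sub_rev x x'] at e2
    rw [inner_sub_left]
    linarith
  obtain ⟨ρ, hρ, r1, r2, r3, r4, r5, r6⟩ : ∃ ρ : ℝ, 0 < ρ ∧ ρ < R / 3 ∧ ρ < ε ∧ κ * ρ < ε ∧
      κ * ρ < γ ∧ ρ < η₀ ∧ κ * ρ < η₀ := by
    have hk : ∀ c : ℝ, 0 < c → ∀ᶠ ρ in 𝓝[>] (0 : ℝ), κ * ρ < c := by
      intro c hc
      have : Tendsto (fun ρ : ℝ => κ * ρ) (𝓝[>] 0) (𝓝 (κ * 0)) :=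
        ((continuous_const_mul κ).tendsto 0).mono_left nhdsWithin_le_nhds
      rw [mul_zero] at this
      exact this.eventually (gt_mem_nhds hc)
    have hk' : ∀ c : ℝ, 0 < c → ∀ᶠ ρ in 𝓝[>] (0 : ℝ), ρ < c := fun c hc =>
      nhdsWithin_le_nhds (gt_mem_nhds hc)
    have hself : ∀ᶠ ρ in 𝓝[>] (0 : ℝ), 0 < ρ := self_mem_nhdsWithin
    exact (hself.and ((hk' (R / 3) (by positivity)).and ((hk' ε hε).and ((hk ε hε).and
      ((hk γ hγ).and ((hk' η₀ hη₀).and (hk η₀ hη₀))))))).exists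
  have hsubset : ∀ p ∈ closedBall (0 : X) ρ, p ∈ ball (0 : X) (R / 3) ∧ p ∈ ball (0 : X) R := by
    intro p hp
    rw [mem_closedBall_zero_iff] at hp
    rw [mem_ball_zero_iff, mem_ball_zero_iff]
    constructor <;> linarith
  have hlipρ : ∀ p ∈ closedBall (0 : X) ρ, ∀ q ∈ closedBall (0 : X) ρ,
      ‖m q - m p‖ ≤ κ * ‖q - p‖ := fun p hp q hq => hlip p (hsubset p hp).2 q (hsubset q hq).2
  have hcoρ : ∀ p ∈ closedBall (0 : X) ρ, ∀ q ∈ closedBall (0 : X) ρ,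
      ‖m q - m p‖ ^ 2 ≤ κ * ⟪m q - m p, q - p⟫ :=
    fun p hp q hq => hco p (hsubset p hp).1 q (hsubset q hq).1
  have hkρ : ∀ p ∈ closedBall (0 : X) ρ, κ * ‖p‖ ≤ κ * ρ := by
    intro p hp
    rw [mem_closedBall_zero_iff] at hp
    gcongr
  have hgrρ : ∀ p ∈ closedBall (0 : X) ρ, p ∈ LimitingSubdiff f (m p) := fun p hp =>
    hgr p (hsubset p hp).2 ((hkρ p hp).trans_lt r4)
  have hη : 0 < ρ / (2 * (1 + s)) := by positivity
  refine ⟨ρ / (2 * (1 + s)), hη, ?_⟩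
  set η := ρ / (2 * (1 + s)) with hηdef
  have hη1 : η * (1 + s) = ρ / 2 := by rw [hηdef]; field_simp
  have hηρ : η < ρ := by nlinarith
  intro r' hr' hr'κ x p hxp hball u w hw
  rw [mem_closedBall, Prod.dist_eq] at hball
  simp only [dist_eq_norm, sub_zero] at hball
  have hx : ‖x - xb‖ ≤ η := (le_max_left _ _).trans hball
  have hp : ‖p‖ ≤ η := (le_max_right _ _).trans hball
  have hxm : x = m p := by
    obtain ⟨p', hp', he⟩ := surj_aux m κ s ρ hκ hspos hρ hcoρ (p + s • x) (by
      have : p + s • x - s • m 0 = p + s • (x - xb) := by rw [hm0]; module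
      rw [this]
      have h1 := norm_add_le p (s • (x - xb))
      rw [norm_smul, Real.norm_of_nonneg hspos.le] at h1
      have h2 : s * ‖x - xb‖ ≤ s * η := by gcongr
      nlinarith)
    have hb := hmxb p' (hsubset p' hp').2
    have hb2 := hkρ p' hp'
    have hb3 := hgrρ p' hp'
    rw [mem_closedBall_zero_iff] at hp'
    have hh := hypo x p (m p') p' (by linarith) (by linarith) (by linarith) (by linarith) hxp
      (by linarith) (by linarith) (by linarith) (by linarith) hb3
    have hpp : p - p' = s • (m p' - x) := by
      have : p = p' + s • m p' - s • x := by rw [he]; abel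
      rw [this]; module
    rw [hpp, inner_smul_left, real_inner_self_eq_norm_sq] at hh
    simp only [conj_trivial] at hh
    have h0' : ‖m p' - x‖ ^ 2 ≤ 0 := by rw [hs] at hh; linarith
    have h1 : m p' - x = 0 := by
      rw [← norm_eq_zero]; exact pow_eq_zero_iff (two_ne_zero) |>.1 (le_antisymm h0' (by positivity))
    rw [h1, smul_zero, sub_eq_zero] at hpp
    rw [hpp]; exact (sub_eq_zero.1 h1).symm
  have hw' : (w, -u) ∈ FrechetNormalP {q : X × X | q.2 ∈ LimitingSubdiff f q.1} (m p, p) := by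
    rw [← hxm]; exact hw
  have main := normal_final _ m κ ρ hκ (fun q hq => hgrρ q hq) hlipρ hcoρ p (by linarith) u w hw'
  have h3 : κ⁻¹ * ‖u‖ ^ 2 ≤ ⟪w, u⟫ := by rwa [inv_mul_le_iff₀ hκ]
  have hpos : 0 ≤ κ⁻¹ * ‖u‖ ^ 2 := by positivity
  refine ⟨?_, ?_, h3⟩
  · by_cases hu : ‖u‖ = 0
    · rw [hu]; positivity
    have hu' : 0 < ‖u‖ := lt_of_le_of_ne (norm_nonneg _) (Ne.symm hu)
    have h4 := real_inner_le_norm w u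
    have h5 : ‖u‖ * ‖u‖ ≤ (κ * ‖w‖) * ‖u‖ := by nlinarith
    exact le_of_mul_le_mul_right h5 hu'
  · have : 0 ≤ r' * ‖u‖ ^ 2 := by positivity
    linarith
end
end
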